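/- arXiv:math/0605012 — 5 statements merged into one kernel-verified Lean document; each statement's English description precedes it below -/
import Mathlib

section
/- For every integer n ≥ 1, every Gaussian integer is congruent modulo (1+i)^n to exactly one element of the set Ω_n = {r + s·i : r, s ∈ ℤ, 0 ≤ r < 2^⌈n/2⌉, 0 ≤ s < 2^(n−⌈n/2⌉)}; that is, Ω_n is a complete set of representatives of ℤ[i]/((1+i)^n). -/
open Complex

noncomputable section

/-- `z ∈ ℤ[i] ⊆ ℂ`. -/
def IsGauss (z : ℂ) : Prop := ∃ a b : ℤ, z = (a : ℂ) + (b : ℂ) * Complex.I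

/-- Divisibility in `ℤ[i]`: `m ∣ z` within the Gaussian integers. -/
def GDvd (m z : ℂ) : Prop := ∃ k : ℂ, IsGauss k ∧ z = m * k

/-- Congruence modulo `m` in `ℤ[i]`. -/
def GCong (m z w : ℂ) : Prop := GDvd m (z - w)

theorem IsGauss.mul {z w : ℂ} (hz : IsGauss z) (hw : IsGauss w) : IsGauss (z * w) := by
  obtain ⟨a, b, rfl⟩ := hz
  obtain ⟨c, d, rfl⟩ := hw
  refine ⟨a * c - b * d, a * d + b * c, ?_⟩
  push_cast
  linear_combination (b * d : ℂ) * Complex.I_mul_I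

theorem isGauss_one_add_I_pow (n : ℕ) : IsGauss ((1 + Complex.I) ^ n) := by
  induction n with
  | zero => exact ⟨1, 0, by simp⟩
  | succ n ih =>
    rw [pow_succ]
    exact ih.mul ⟨1, 1, by simp⟩

theorem gauss_ext {a b c d : ℤ}
    (h : (a : ℂ) + (b : ℂ) * Complex.I = (c : ℂ) + (d : ℂ) * Complex.I) : a = c ∧ b = d := by
  have h₁ := congrArg Complex.re h
  have h₂ := congrArg Complex.im h
  simp at h₁ h₂
  exact ⟨h₁, h₂⟩

theorem gDvd_pow_succ_iff (n : ℕ) (a b : ℤ) :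
    GDvd ((1 + Complex.I) ^ (n + 1)) ((a : ℂ) + (b : ℂ) * Complex.I) ↔
      ∃ c d : ℤ, a = c - d ∧ b = c + d ∧
        GDvd ((1 + Complex.I) ^ n) ((c : ℂ) + (d : ℂ) * Complex.I) := by
  constructor
  · rintro ⟨k, hk, h⟩
    obtain ⟨c, d, hcd⟩ := (isGauss_one_add_I_pow n).mul hk
    have h' : (a : ℂ) + (b : ℂ) * Complex.I
        = ((c - d : ℤ) : ℂ) + ((c + d : ℤ) : ℂ) * Complex.I := by
      push_cast
      linear_combination h + (1 + Complex.I) * hcd + (d : ℂ) * Complex.I_mul_I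
    obtain ⟨ha, hb⟩ := gauss_ext h'
    exact ⟨c, d, ha, hb, k, hk, hcd.symm⟩
  · rintro ⟨c, d, rfl, rfl, k, hk, h⟩
    refine ⟨k, hk, ?_⟩
    push_cast
    linear_combination (1 + Complex.I) * h - (d : ℂ) * Complex.I_mul_I

/-- Divisibility by `(1 + i) ^ n` in terms of integer coordinates. -/
theorem gDvd_one_add_I_pow_iff (n : ℕ) (a b : ℤ) :
    GDvd ((1 + Complex.I) ^ n) ((a : ℂ) + (b : ℂ) * Complex.I) ↔
      (2 : ℤ) ^ (n - (n + 1) / 2) ∣ b ∧ (2 : ℤ) ^ ((n + 1) / 2) ∣ a - b := by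
  induction n generalizing a b with
  | zero => simpa [GDvd] using ⟨a, b, rfl⟩
  | succ n ih =>
    have hq : n + 1 - (n + 1 + 1) / 2 = (n + 1) / 2 := by omega
    have hp : (n + 1 + 1) / 2 = n - (n + 1) / 2 + 1 := by omega
    have hle : (2 : ℤ) ^ ((n + 1) / 2) ∣ 2 ^ (n - (n + 1) / 2 + 1) :=
      pow_dvd_pow 2 (by omega)
    rw [gDvd_pow_succ_iff, hq, hp]
    simp only [ih]
    constructor
    · rintro ⟨c, d, rfl, rfl, ⟨e, rfl⟩, h⟩
      have h₂ : (2 : ℤ) ^ (n - (n + 1) / 2 + 1) ∣ 2 ^ (n - (n + 1) / 2 + 1) * e :=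
        Dvd.intro _ rfl
      refine ⟨?_, -e, by ring⟩
      have := dvd_add h (hle.trans h₂)
      rwa [show c - 2 ^ (n - (n + 1) / 2) * e + 2 ^ (n - (n + 1) / 2 + 1) * e
        = c + 2 ^ (n - (n + 1) / 2) * e by ring] at this
    · rintro ⟨hb, e, he⟩
      have ha : (2 : ℤ) ^ ((n + 1) / 2) ∣ a := by
        have := dvd_add (hle.trans (Dvd.intro e he.symm)) hb
        rwa [sub_add_cancel] at this
      rw [pow_succ] at he
      refine ⟨b + 2 ^ (n - (n + 1) / 2) * e, -(2 ^ (n - (n + 1) / 2) * e), ?_, ?_, ?_, ?_⟩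
      · linear_combination he
      · ring
      · exact (Dvd.intro _ rfl).neg_right
      · convert ha using 1
        linear_combination -he

theorem gCong_one_add_I_pow_iff (n : ℕ) (a b r s : ℤ) :
    GCong ((1 + Complex.I) ^ n) ((a : ℂ) + (b : ℂ) * Complex.I)
        ((r : ℂ) + (s : ℂ) * Complex.I) ↔
      (2 : ℤ) ^ (n - (n + 1) / 2) ∣ b - s ∧ (2 : ℤ) ^ ((n + 1) / 2) ∣ (a - b + s) - r := by
  have h : (a : ℂ) + (b : ℂ) * Complex.I - ((r : ℂ) + (s : ℂ) * Complex.I)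
      = ((a - r : ℤ) : ℂ) + ((b - s : ℤ) : ℂ) * Complex.I := by
    push_cast
    ring
  rw [GCong, h, gDvd_one_add_I_pow_iff, show a - r - (b - s) = a - b + s - r by ring]

theorem Int.eq_emod_of_dvd_sub {m x r : ℤ} (h₀ : 0 ≤ r) (h₁ : r < m) (h : m ∣ x - r) :
    r = x % m := by
  rw [Int.emod_eq_emod_iff_emod_sub_eq_zero.mpr (Int.emod_eq_zero_of_dvd h),
    Int.emod_eq_of_lt h₀ h₁]

/-- For every `n ≥ 1`, the set `Ω_n = {r + s·i : 0 ≤ r < 2^⌈n/2⌉, 0 ≤ s < 2^(n−⌈n/2⌉)}`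
is a complete set of representatives of `ℤ[i]/((1+i)^n)`: every Gaussian integer is
congruent mod `(1+i)^n` to exactly one element of `Ω_n`.  (Here `⌈n/2⌉ = (n+1)/2`.) -/
theorem stmt1 (n : ℕ) (hn : 1 ≤ n) (z : ℂ) (hz : IsGauss z) :
    ∃! w : ℂ,
      (∃ r s : ℤ, 0 ≤ r ∧ r < 2 ^ ((n + 1) / 2) ∧ 0 ≤ s ∧ s < 2 ^ (n - (n + 1) / 2) ∧
        w = (r : ℂ) + (s : ℂ) * Complex.I) ∧
      GCong ((1 + Complex.I) ^ n) z w := by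
  obtain ⟨a, b, rfl⟩ := hz
  have hp : (0 : ℤ) < 2 ^ ((n + 1) / 2) := by positivity
  have hq : (0 : ℤ) < 2 ^ (n - (n + 1) / 2) := by positivity
  set s : ℤ := b % 2 ^ (n - (n + 1) / 2) with hs
  set r : ℤ := (a - b + s) % 2 ^ ((n + 1) / 2) with hr
  refine ⟨(r : ℂ) + (s : ℂ) * Complex.I, ⟨⟨r, s, Int.emod_nonneg _ hp.ne', Int.emod_lt_of_pos _ hp,
    Int.emod_nonneg _ hq.ne', Int.emod_lt_of_pos _ hq, rfl⟩, ?_⟩, ?_⟩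
  · rw [gCong_one_add_I_pow_iff]
    exact ⟨Int.dvd_self_sub_emod, Int.dvd_self_sub_emod⟩
  · rintro w ⟨⟨r', s', hr₀, hr₁, hs₀, hs₁, rfl⟩, h⟩
    rw [gCong_one_add_I_pow_iff] at h
    obtain rfl : s' = s := Int.eq_emod_of_dvd_sub hs₀ hs₁ h.1
    obtain rfl : r' = r := Int.eq_emod_of_dvd_sub hr₀ hr₁ h.2
    rfl
end
end

section
/- Let N be a nonzero Gaussian integer, and for every nonzero y ∈ ℤ[i] let Ω(y) ⊆ ℤ[i] be a fixed complete set of representatives of ℤ[i]/(y). Then every 2×2 matrix α over ℤ[i] with det α = N admits a factorization α = γ · !![m, x; 0, N/m], where γ ∈ SL(2,ℤ[i]), m ∈ ℤ[i] divides N, the quotient N/m is standard, and x ∈ Ω(N/m); moreover the triple (γ, m, x) with these properties is unique. (Gaussian-integer Hecke decomposition.) -/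
open Complex Matrix

noncomputable section

/-- A nonzero Gaussian integer is *standard* if its real part is positive and its imaginary
part is nonnegative. -/
def IsStandard (z : ℂ) : Prop := 0 < z.re ∧ 0 ≤ z.im

theorem isGauss_iff_exists_toComplex {z : ℂ} :
    IsGauss z ↔ ∃ w : GaussianInt, GaussianInt.toComplex w = z := by
  constructor
  · rintro ⟨a, b, rfl⟩
    exact ⟨⟨a, b⟩, GaussianInt.toComplex_def' a b⟩
  · rintro ⟨w, rfl⟩
    exact ⟨w.re, w.im, GaussianInt.toComplex_def w⟩

namespace IsGauss

theorem zero : IsGauss 0 := ⟨0, 0, by simp⟩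

theorem one : IsGauss 1 := ⟨1, 0, by simp⟩

theorem I : IsGauss Complex.I := ⟨0, 1, by simp⟩

variable {z w : ℂ}

theorem add (hz : IsGauss z) (hw : IsGauss w) : IsGauss (z + w) := by
  rw [isGauss_iff_exists_toComplex] at *
  obtain ⟨a, rfl⟩ := hz
  obtain ⟨b, rfl⟩ := hw
  exact ⟨a + b, map_add _ _ _⟩

theorem neg (hz : IsGauss z) : IsGauss (-z) := by
  rw [isGauss_iff_exists_toComplex] at *
  obtain ⟨a, rfl⟩ := hz
  exact ⟨-a, map_neg _ _⟩

theorem sub (hz : IsGauss z) (hw : IsGauss w) : IsGauss (z - w) := by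
  simpa [sub_eq_add_neg] using hz.add hw.neg

theorem mul_s2 (hz : IsGauss z) (hw : IsGauss w) : IsGauss (z * w) := by
  rw [isGauss_iff_exists_toComplex] at *
  obtain ⟨a, rfl⟩ := hz
  obtain ⟨b, rfl⟩ := hw
  exact ⟨a * b, map_mul _ _ _⟩

/-- Bézout's identity in `ℤ[i]`, with the common divisor factored out. -/
theorem exists_bezout {a c : ℂ} (ha : IsGauss a) (hc : IsGauss c) (h : a ≠ 0 ∨ c ≠ 0) :
    ∃ g a' c' u v : ℂ, IsGauss g ∧ IsGauss a' ∧ IsGauss c' ∧ IsGauss u ∧ IsGauss v ∧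
      a = g * a' ∧ c = g * c' ∧ u * a' + v * c' = 1 := by
  rw [isGauss_iff_exists_toComplex] at ha hc
  obtain ⟨a, rfl⟩ := ha
  obtain ⟨c, rfl⟩ := hc
  obtain ⟨a', ha'⟩ := EuclideanDomain.gcd_dvd_left a c
  obtain ⟨c', hc'⟩ := EuclideanDomain.gcd_dvd_right a c
  have hg : EuclideanDomain.gcd a c ≠ 0 := by
    intro h0
    obtain ⟨rfl, rfl⟩ := EuclideanDomain.gcd_eq_zero_iff.mp h0
    simp at h
  have hb := EuclideanDomain.gcd_eq_gcd_ab a c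
  set g := EuclideanDomain.gcd a c
  set u := EuclideanDomain.gcdA a c
  set v := EuclideanDomain.gcdB a c
  have hone : u * a' + v * c' = 1 := by
    refine mul_left_cancel₀ hg ?_
    calc g * (u * a' + v * c') = (g * a') * u + (g * c') * v := by ring
      _ = g * 1 := by rw [← ha', ← hc', ← hb, mul_one]
  have hG (w : GaussianInt) : IsGauss (GaussianInt.toComplex w) :=
    isGauss_iff_exists_toComplex.mpr ⟨w, rfl⟩
  refine ⟨g, a', c', u, v, hG _, hG _, hG _, hG _, hG _, ?_, ?_, ?_⟩
  · rw [← map_mul, ← ha']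
  · rw [← map_mul, ← hc']
  · rw [← map_mul, ← map_mul, ← map_add, hone, map_one]

end IsGauss

/-- Every nonzero complex number is moved into the standard quadrant by some unit of `ℤ[i]`. -/
theorem exists_unit_mul_isStandard {z : ℂ} (hz : z ≠ 0) :
    ∃ e f : ℂ, IsGauss e ∧ IsGauss f ∧ e * f = 1 ∧ IsStandard (e * z) := by
  by_cases h1 : 0 < z.re ∧ 0 ≤ z.im
  · exact ⟨1, 1, .one, .one, by simp, by simpa [IsStandard] using h1⟩
  by_cases h2 : z.re < 0 ∧ z.im ≤ 0
  · exact ⟨-1, -1, IsGauss.one.neg, IsGauss.one.neg, by simp, by simpa [IsStandard] using h2⟩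
  by_cases h3 : z.im < 0 ∧ 0 ≤ z.re
  · exact ⟨Complex.I, -Complex.I, .I, IsGauss.I.neg, by simp, by simpa [IsStandard] using h3⟩
  by_cases h4 : 0 < z.im ∧ z.re ≤ 0
  · exact ⟨-Complex.I, Complex.I, IsGauss.I.neg, .I, by simp, by simpa [IsStandard] using h4⟩
  refine absurd (Complex.ext ?_ ?_) hz <;> simp only [Complex.zero_re, Complex.zero_im] <;> grind

/-- A unit of `ℤ[i]` is one of `1`, `-1`, `I`, `-I`. -/
theorem IsGauss.eq_of_mul_eq_one {e f : ℂ} (he : IsGauss e) (hf : IsGauss f) (h : e * f = 1) :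
    e = 1 ∨ e = -1 ∨ e = Complex.I ∨ e = -Complex.I := by
  obtain ⟨a, b, rfl⟩ := he
  obtain ⟨c, d, rfl⟩ := hf
  have hn := congrArg Complex.normSq h
  simp only [map_mul, map_one, Complex.normSq_apply] at hn
  simp at hn
  have hn' : (a * a + b * b) * (c * c + d * d) = 1 := by exact_mod_cast hn
  have hab : a * a + b * b = 1 :=
    Int.eq_one_of_mul_eq_one_right (add_nonneg (mul_self_nonneg a) (mul_self_nonneg b)) hn'
  have ha : -1 ≤ a ∧ a ≤ 1 := by constructor <;> nlinarith
  have hb : -1 ≤ b ∧ b ≤ 1 := by constructor <;> nlinarith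
  obtain ⟨ha1, ha2⟩ := ha
  obtain ⟨hb1, hb2⟩ := hb
  interval_cases a <;> interval_cases b <;> simp at hab ⊢

/-- Distinct standard numbers are not related by a unit of `ℤ[i]`. -/
theorem IsStandard.unit_eq_one {e f z : ℂ} (he : IsGauss e) (hf : IsGauss f) (h : e * f = 1)
    (hz : IsStandard z) (hez : IsStandard (e * z)) : e = 1 := by
  obtain ⟨h1, h2⟩ := hz
  obtain ⟨h3, h4⟩ := hez
  rcases he.eq_of_mul_eq_one hf h with rfl | rfl | rfl | rfl
  · rfl
  all_goals
    simp at h3 h4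
    linarith

/-- Existence of the Hecke decomposition, in terms of matrix entries. -/
theorem exists_hecke_entries (Ω : ℂ → Set ℂ)
    (hΩ : ∀ y z : ℂ, IsGauss y → y ≠ 0 → IsGauss z → ∃ w ∈ Ω y, GCong y z w)
    {a b c d : ℂ} (ha : IsGauss a) (hb : IsGauss b) (hc : IsGauss c) (hd : IsGauss d)
    (hdet : a * d - b * c ≠ 0) :
    ∃ p q r s m n x : ℂ, IsGauss p ∧ IsGauss q ∧ IsGauss r ∧ IsGauss s ∧ p * s - q * r = 1 ∧
      IsGauss m ∧ IsGauss n ∧ m * n = a * d - b * c ∧ IsStandard n ∧ x ∈ Ω n ∧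
      a = p * m ∧ b = p * x + q * n ∧ c = r * m ∧ d = r * x + s * n := by
  have hac : a ≠ 0 ∨ c ≠ 0 := by
    by_contra! h
    simp [h.1, h.2] at hdet
  obtain ⟨g, a', c', u, v, hg, ha', hc', hu, hv, rfl, rfl, huv⟩ := ha.exists_bezout hc hac
  have hM : a' * d - b * c' ≠ 0 := fun h0 => hdet (by linear_combination g * h0)
  obtain ⟨e, f, he, hf, hef, hstd⟩ := exists_unit_mul_isStandard hM
  have hn : IsGauss (e * (a' * d - b * c')) := he.mul_s2 ((ha'.mul_s2 hd).sub (hb.mul_s2 hc'))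
  have hn0 : e * (a' * d - b * c') ≠ 0 := mul_ne_zero (left_ne_zero_of_mul_eq_one hef) hM
  obtain ⟨x, hx, k, hk, hxk⟩ :=
    hΩ _ (f * (u * b + v * d)) hn hn0 (hf.mul_s2 ((hu.mul_s2 hb).add (hv.mul_s2 hd)))
  refine ⟨e * a', -(f * v) + k * (e * a'), e * c', f * u + k * (e * c'), g * f,
    e * (a' * d - b * c'), x, he.mul_s2 ha', (hf.mul_s2 hv).neg.add (hk.mul_s2 (he.mul_s2 ha')), he.mul_s2 hc',
    (hf.mul_s2 hu).add (hk.mul_s2 (he.mul_s2 hc')), ?_, hg.mul_s2 hf, hn, ?_, hstd, hx, ?_, ?_, ?_, ?_⟩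
  · linear_combination huv + (u * a' + v * c') * hef
  · linear_combination (g * (a' * d - b * c')) * hef
  · linear_combination (-(g * a')) * hef
  · linear_combination (-b) * huv + (-(b * (u * a' + v * c'))) * hef + (e * a') * hxk
  · linear_combination (-(g * c')) * hef
  · linear_combination (-d) * huv + (-(d * (u * a' + v * c'))) * hef + (e * c') * hxk

/-- Uniqueness of the Hecke decomposition, in terms of matrix entries. -/
theorem hecke_entries_unique {S : ℂ → Set ℂ}
    (hS : ∀ y x x' : ℂ, IsGauss y → y ≠ 0 → x ∈ S y → x' ∈ S y → GCong y x x' → x = x')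
    {p q r s m n x p' q' r' s' m' n' x' : ℂ}
    (hp : IsGauss p) (hq : IsGauss q) (hr : IsGauss r) (hs : IsGauss s)
    (hdet : p * s - q * r = 1)
    (hp' : IsGauss p') (hq' : IsGauss q') (hr' : IsGauss r') (hs' : IsGauss s')
    (hdet' : p' * s' - q' * r' = 1)
    (hn : IsGauss n) (hm0 : m ≠ 0) (hmn : m * n = m' * n')
    (hstd : IsStandard n) (hstd' : IsStandard n') (hx : x ∈ S n) (hx' : x' ∈ S n')
    (ha : p * m = p' * m') (hb : p * x + q * n = p' * x' + q' * n')
    (hc : r * m = r' * m') (hd : r * x + s * n = r' * x' + s' * n') :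
    p = p' ∧ q = q' ∧ r = r' ∧ s = s' ∧ m = m' ∧ x = x' := by
  have hn0 : n ≠ 0 := by
    rintro rfl
    simp [IsStandard] at hstd
  have hm : m = m' * (p' * s - q * r') := by
    linear_combination (-m) * hdet + s * ha - q * hc
  have hm' : m' = m * (p * s' - q' * r) := by
    linear_combination (-m') * hdet' - s' * ha + q' * hc
  have hunit : (p * s' - q' * r) * (p' * s - q * r') = 1 := by
    refine mul_left_cancel₀ hm0 ?_
    rw [← mul_assoc, ← hm', ← hm, mul_one]
  have hnn : n = (p * s' - q' * r) * n' := by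
    refine mul_left_cancel₀ hm0 ?_
    rw [hmn, ← mul_assoc, ← hm']
  have h1 : p * s' - q' * r = 1 :=
    hstd'.unit_eq_one ((hp.mul_s2 hs').sub (hq'.mul_s2 hr)) ((hp'.mul_s2 hs).sub (hq.mul_s2 hr')) hunit
      (hnn ▸ hstd)
  rw [h1, mul_one] at hm'
  rw [h1, one_mul] at hnn
  subst hm' hnn
  obtain rfl := mul_right_cancel₀ hm0 ha
  obtain rfl := mul_right_cancel₀ hm0 hc
  obtain rfl : x = x' := by
    refine hS n x x' hn hn0 hx hx'
      ⟨s * (q' - q) - q * (s' - s), (hs.mul_s2 (hq'.sub hq)).sub (hq.mul_s2 (hs'.sub hs)), ?_⟩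
    linear_combination (-(x - x')) * hdet + s * hb - q * hd
  exact ⟨rfl, mul_right_cancel₀ hn0 (add_left_cancel hb), rfl,
    mul_right_cancel₀ hn0 (add_left_cancel hd), rfl, rfl⟩

/-- Gaussian-integer Hecke decomposition: if `N ∈ ℤ[i]` is nonzero and, for each nonzero
`y ∈ ℤ[i]`, `Ω y ⊆ ℤ[i]` is a complete set of representatives of `ℤ[i]/(y)`, then every
`2×2` matrix `α` over `ℤ[i]` with `det α = N` factors uniquely as
`α = γ · !![m, x; 0, N/m]` with `γ ∈ SL(2,ℤ[i])`, `m ∣ N` in `ℤ[i]`, `N/m` standard, and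
`x ∈ Ω (N/m)`. -/
theorem stmt2 (N : ℂ) (hN : IsGauss N) (hN0 : N ≠ 0)
    (Ω : ℂ → Set ℂ)
    (hΩ : ∀ y : ℂ, IsGauss y → y ≠ 0 →
      (∀ w ∈ Ω y, IsGauss w) ∧ (∀ z : ℂ, IsGauss z → ∃! w : ℂ, w ∈ Ω y ∧ GCong y z w))
    (α : Matrix (Fin 2) (Fin 2) ℂ) (hα : ∀ i j, IsGauss (α i j)) (hdet : α.det = N) :
    ∃! t : Matrix (Fin 2) (Fin 2) ℂ × ℂ × ℂ,
      (∀ i j, IsGauss (t.1 i j)) ∧ t.1.det = 1 ∧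
      IsGauss t.2.1 ∧ GDvd t.2.1 N ∧ IsStandard (N / t.2.1) ∧
      t.2.2 ∈ Ω (N / t.2.1) ∧
      α = t.1 * !![t.2.1, t.2.2; 0, N / t.2.1] := by
  have hd0 : α 0 0 * α 1 1 - α 0 1 * α 1 0 = N := by rw [← hdet, Matrix.det_fin_two]
  have hexists : ∀ y z : ℂ, IsGauss y → y ≠ 0 → IsGauss z → ∃ w ∈ Ω y, GCong y z w :=
    fun y z hy hy0 hz => ((hΩ y hy hy0).2 z hz).exists
  have hunique : ∀ y x x' : ℂ, IsGauss y → y ≠ 0 → x ∈ Ω y → x' ∈ Ω y → GCong y x x' →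
      x = x' := fun y x x' hy hy0 hx hx' h =>
    ((hΩ y hy hy0).2 x ((hΩ y hy hy0).1 x hx)).unique
      ⟨hx, 0, .zero, by simp⟩ ⟨hx', h⟩
  obtain ⟨p, q, r, s, m, n, x, hp, hq, hr, hs, hpq, hm, hn, hmn, hstd, hx, ha, hb, hc, hd⟩ :=
    exists_hecke_entries Ω hexists (hα 0 0) (hα 0 1) (hα 1 0) (hα 1 1) (hd0 ▸ hN0)
  rw [hd0] at hmn
  have hm0 : m ≠ 0 := left_ne_zero_of_mul (hmn ▸ hN0)
  have hNm : N / m = n := by rw [← hmn, mul_div_cancel_left₀ _ hm0]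
  refine ⟨(!![p, q; r, s], m, x), ⟨?_, ?_, hm, ⟨n, hn, hmn.symm⟩, ?_, ?_, ?_⟩, ?_⟩
  · simp [Fin.forall_fin_two, hp, hq, hr, hs]
  · simpa [Matrix.det_fin_two] using hpq
  · simpa only [hNm] using hstd
  · simpa only [hNm] using hx
  · ext i j
    fin_cases i <;> fin_cases j <;> simp [Matrix.mul_apply, hNm, ha, hb, hc, hd]
  · rintro ⟨γ, m', x'⟩ ⟨hγ, hγdet, -, ⟨k, -, hk⟩, hstd', hx', hα'⟩
    dsimp only at *
    have hm0' : m' ≠ 0 := left_ne_zero_of_mul (hk ▸ hN0)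
    rw [Matrix.det_fin_two] at hγdet
    have ha' := congrFun₂ hα' 0 0
    have hb' := congrFun₂ hα' 0 1
    have hc' := congrFun₂ hα' 1 0
    have hd' := congrFun₂ hα' 1 1
    simp [Matrix.mul_apply] at ha' hb' hc' hd'
    obtain ⟨h1, h2, h3, h4, h5, h6⟩ := hecke_entries_unique hunique hp hq hr hs hpq
      (hγ 0 0) (hγ 0 1) (hγ 1 0) (hγ 1 1) hγdet hn hm0
      (hmn.trans (mul_div_cancel₀ N hm0').symm) hstd hstd' hx hx'
      (ha.symm.trans ha') (hb.symm.trans hb') (hc.symm.trans hc') (hd.symm.trans hd')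
    rw [Matrix.eta_fin_two γ, h1, h2, h3, h4, h5, h6]
end
end

section
/- The group Γ' is the disjoint union of the six sets obtained by letting δ and ε range over {0,1}: the two sets ω₈^(−δ) · Ξ₁₂ · !![i^δ, 0; 0, 1] and the four sets (ω₈^δ·(1+i))^(−1) · Ξ₂ · !![i^(1+δ), i^ε; 0, 2]. Equivalently, a matrix g ∈ SL(2,ℂ) has all entries of C(g) in ℤ[i] if and only if g lies in exactly one of these six sets. -/
open Complex Matrix

noncomputable section

/-- The matrix of the conjugation action of `g ∈ SL(2,ℂ)` on `sl₂(ℂ)` in the trace-form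
orthonormal basis. -/
def CMat (g : Matrix (Fin 2) (Fin 2) ℂ) : Matrix (Fin 3) (Fin 3) ℂ :=
  !![(g 0 0 ^ 2 - g 1 0 ^ 2 + g 1 1 ^ 2 - g 0 1 ^ 2) / 2,
     Complex.I * (g 0 0 ^ 2 - g 1 0 ^ 2 + g 0 1 ^ 2 - g 1 1 ^ 2) / 2,
     g 1 0 * g 1 1 - g 0 0 * g 0 1;
     Complex.I * (g 0 1 ^ 2 + g 1 1 ^ 2 - g 0 0 ^ 2 - g 1 0 ^ 2) / 2,
     (g 0 0 ^ 2 + g 1 0 ^ 2 + g 0 1 ^ 2 + g 1 1 ^ 2) / 2,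
     Complex.I * (g 0 0 * g 0 1 + g 1 0 * g 1 1);
     -(g 0 0 * g 1 0) + g 0 1 * g 1 1,
     Complex.I * (g 0 0 * g 1 0 + g 0 1 * g 1 1),
     g 0 0 * g 1 1 + g 0 1 * g 1 0]

/-- `Γ' ⊆ SL(2,ℂ)`: the preimage under `C` of `SO(3,ℤ[i])`. -/
def GammaSet : Set (Matrix (Fin 2) (Fin 2) ℂ) :=
  {g | g.det = 1 ∧ ∀ i j, IsGauss (CMat g i j)}

/-- `Ξ₁₂`: matrices of `SL(2,ℤ[i])` reducing mod `1+i` to `!![1,0;0,1]` or `!![0,1;1,0]`. -/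
def Xi12 : Set (Matrix (Fin 2) (Fin 2) ℂ) :=
  {g | (∀ i j, IsGauss (g i j)) ∧ g.det = 1 ∧
    ((GCong (1 + Complex.I) (g 0 0) 1 ∧ GCong (1 + Complex.I) (g 0 1) 0 ∧
      GCong (1 + Complex.I) (g 1 0) 0 ∧ GCong (1 + Complex.I) (g 1 1) 1) ∨
     (GCong (1 + Complex.I) (g 0 0) 0 ∧ GCong (1 + Complex.I) (g 0 1) 1 ∧
      GCong (1 + Complex.I) (g 1 0) 1 ∧ GCong (1 + Complex.I) (g 1 1) 0))}

/-- `Ξ₂`: matrices of `SL(2,ℤ[i])` reducing mod `1+i` to `!![1,1;1,0]` or `!![1,0;1,1]`. -/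
def Xi2 : Set (Matrix (Fin 2) (Fin 2) ℂ) :=
  {g | (∀ i j, IsGauss (g i j)) ∧ g.det = 1 ∧
    ((GCong (1 + Complex.I) (g 0 0) 1 ∧ GCong (1 + Complex.I) (g 0 1) 1 ∧
      GCong (1 + Complex.I) (g 1 0) 1 ∧ GCong (1 + Complex.I) (g 1 1) 0) ∨
     (GCong (1 + Complex.I) (g 0 0) 1 ∧ GCong (1 + Complex.I) (g 0 1) 0 ∧
      GCong (1 + Complex.I) (g 1 0) 1 ∧ GCong (1 + Complex.I) (g 1 1) 1))}

/-- `ω₈ = (1+i)/√2`, the standard primitive eighth root of unity. -/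
def omega8 : ℂ := (1 + Complex.I) / (Real.sqrt 2 : ℝ)

/-- The six sets: `ω₈^(−δ)·Ξ₁₂·!![i^δ,0;0,1]` (δ ∈ {0,1}) and
`(ω₈^δ·(1+i))⁻¹·Ξ₂·!![i^(1+δ), i^ε; 0, 2]` (δ, ε ∈ {0,1}). -/
def sixSet : Fin 2 ⊕ (Fin 2 × Fin 2) → Set (Matrix (Fin 2) (Fin 2) ℂ)
  | Sum.inl δ =>
      (fun ξ => (omega8 ^ (δ : ℕ))⁻¹ • (ξ * !![Complex.I ^ (δ : ℕ), 0; 0, 1])) '' Xi12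
  | Sum.inr (δ, ε) =>
      (fun ξ => (omega8 ^ (δ : ℕ) * (1 + Complex.I))⁻¹ •
        (ξ * !![Complex.I ^ (1 + (δ : ℕ)), Complex.I ^ (ε : ℕ); 0, 2])) '' Xi2

/-- The imaginary unit of `ℤ[i]`. -/
def gaussI : GaussianInt := ⟨0, 1⟩

@[simp] lemma toComplex_gaussI : (gaussI : ℂ) = Complex.I := by
  simp [gaussI, GaussianInt.toComplex_def]

lemma gaussI_sq : gaussI ^ 2 = -1 := by
  ext <;> simp [gaussI, pow_two]

lemma isGauss_iff (z : ℂ) : IsGauss z ↔ ∃ x : GaussianInt, (x : ℂ) = z := by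
  constructor
  · rintro ⟨a, b, rfl⟩
    exact ⟨⟨a, b⟩, by simp [GaussianInt.toComplex_def]⟩
  · rintro ⟨x, rfl⟩
    exact ⟨x.re, x.im, GaussianInt.toComplex_def x⟩

/-- Reduction modulo `1 + i`. -/
def gaussMod : GaussianInt →+* ZMod 2 := Zsqrtd.lift ⟨1, by decide⟩

lemma gaussMod_apply (z : GaussianInt) : gaussMod z = (z.re : ZMod 2) + z.im := by
  simp [gaussMod, Zsqrtd.lift]

@[simp] lemma gaussMod_gaussI : gaussMod gaussI = 1 := by
  simp [gaussMod_apply, gaussI]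

lemma gaussMod_eq_zero_iff (z : GaussianInt) : gaussMod z = 0 ↔ 1 + gaussI ∣ z := by
  constructor
  · intro h
    rw [gaussMod_apply, ← Int.cast_add, ZMod.intCast_zmod_eq_zero_iff_dvd] at h
    obtain ⟨m, hm⟩ := h
    refine ⟨⟨m, m - z.re⟩, ?_⟩
    push_cast at hm
    ext <;> simp [gaussI] <;> omega
  · rintro ⟨k, rfl⟩
    have : (1 + 1 : ZMod 2) = 0 := by decide
    simp [this]

lemma two_eq_one_add_gaussI_sq : (2 : GaussianInt) = -gaussI * (1 + gaussI) ^ 2 := by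
  linear_combination (gaussI + 2) * gaussI_sq

lemma two_dvd_sq {z : GaussianInt} (h : gaussMod z = 0) : 2 ∣ z ^ 2 := by
  obtain ⟨k, rfl⟩ := (gaussMod_eq_zero_iff z).1 h
  exact ⟨gaussI * k ^ 2, by linear_combination k ^ 2 * gaussI_sq⟩

lemma exists_eq_of_gaussMod_eq_one {z : GaussianInt} (h : gaussMod z = 1) :
    ∃ (n : ℤ) (k m : GaussianInt), z = 1 + (1 + gaussI) * n + 2 * k ∧
      z ^ 2 = 1 + 2 * n + 4 * m := by
  have h' : gaussMod (z - 1) = 0 := by simp [h]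
  rw [gaussMod_apply, ← Int.cast_add, ZMod.intCast_zmod_eq_zero_iff_dvd] at h'
  obtain ⟨j, hj⟩ := h'
  obtain ⟨l, hl⟩ := Int.even_mul_succ_self z.im
  have hl' : (z.im : GaussianInt) * (z.im + 1) = l + l := by exact_mod_cast hl
  have hz : z = 1 + (1 + gaussI) * z.im + 2 * ((j - z.im : ℤ) : GaussianInt) := by
    simp only [Zsqrtd.re_sub, Zsqrtd.im_sub, Zsqrtd.re_one, Zsqrtd.im_one] at hj
    push_cast at hj
    ext <;> simp [gaussI] <;> omega
  generalize (j - z.im : ℤ) = k at hz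
  generalize z.im = n at hz hl'
  refine ⟨n, k, gaussI * l + k + (1 + gaussI) * n * k + k ^ 2, hz, ?_⟩
  subst hz
  linear_combination (n : GaussianInt) ^ 2 * gaussI_sq + 2 * gaussI * hl'

lemma two_dvd_sq_sub_one {z : GaussianInt} (h : gaussMod z = 1) : 2 ∣ z ^ 2 - 1 := by
  obtain ⟨n, k, m, -, h⟩ := exists_eq_of_gaussMod_eq_one h
  exact ⟨n + 2 * m, by linear_combination h⟩

lemma gaussMod_of_two_dvd {z : GaussianInt} (h : (2 : GaussianInt) ∣ z) : gaussMod z = 0 := by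
  obtain ⟨k, rfl⟩ := h
  rw [map_mul, show gaussMod 2 = 0 from by rw [map_ofNat]; decide, zero_mul]

lemma gCong_iff (x y : GaussianInt) :
    GCong (1 + Complex.I) (x : ℂ) y ↔ gaussMod x = gaussMod y := by
  rw [← sub_eq_zero, ← map_sub, gaussMod_eq_zero_iff]
  constructor
  · rintro ⟨k, hk, h⟩
    obtain ⟨k, rfl⟩ := (isGauss_iff k).1 hk
    refine ⟨k, ?_⟩
    rw [← GaussianInt.toComplex_inj]
    simpa using h
  · rintro ⟨k, h⟩
    refine ⟨k, (isGauss_iff _).2 ⟨k, rfl⟩, ?_⟩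
    rw [← GaussianInt.toComplex_sub, h]
    simp

/-- The matrix `!![p, q; r, s]` over `ℤ[i]`, seen over `ℂ`. -/
def gaussMat (p q r s : GaussianInt) : Matrix (Fin 2) (Fin 2) ℂ := !![(p : ℂ), q; r, s]

lemma det_gaussMat (p q r s : GaussianInt) :
    (gaussMat p q r s).det = 1 ↔ p * s - q * r = 1 := by
  rw [gaussMat, Matrix.det_fin_two_of, ← GaussianInt.toComplex_inj]
  simp

lemma zmod_two_sum_eq_zero : ∀ p q r s : ZMod 2, p * s - q * r = 1 →
    (p + q + r + s = 0 ↔ (p = 1 ∧ q = 0 ∧ r = 0 ∧ s = 1) ∨ (p = 0 ∧ q = 1 ∧ r = 1 ∧ s = 0)) := by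
  decide

lemma zmod_two_fst_col : ∀ p q r s : ZMod 2, p * s - q * r = 1 →
    ((p = 1 ∧ r = 1) ↔ (p = 1 ∧ q = 1 ∧ r = 1 ∧ s = 0) ∨ (p = 1 ∧ q = 0 ∧ r = 1 ∧ s = 1)) := by
  decide

lemma eq_gaussMat {g : Matrix (Fin 2) (Fin 2) ℂ} (h : ∀ i j, IsGauss (g i j)) :
    ∃ p q r s, g = gaussMat p q r s := by
  simp only [isGauss_iff] at h
  choose x hx using h
  refine ⟨x 0 0, x 0 1, x 1 0, x 1 1, ?_⟩
  ext i j
  fin_cases i <;> fin_cases j <;> simp [gaussMat, hx]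

lemma isGauss_gaussMat (p q r s : GaussianInt) (i j) : IsGauss (gaussMat p q r s i j) := by
  rw [isGauss_iff]
  fin_cases i <;> fin_cases j <;> simp [gaussMat]

lemma gCong_one_iff (x : GaussianInt) :
    GCong (1 + Complex.I) (x : ℂ) 1 ↔ gaussMod x = 1 := by
  simpa using gCong_iff x 1

lemma gCong_zero_iff (x : GaussianInt) :
    GCong (1 + Complex.I) (x : ℂ) 0 ↔ gaussMod x = 0 := by
  simpa using gCong_iff x 0

lemma mem_Xi12_iff (g : Matrix (Fin 2) (Fin 2) ℂ) :
    g ∈ Xi12 ↔ ∃ p q r s, g = gaussMat p q r s ∧ p * s - q * r = 1 ∧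
      gaussMod p + gaussMod q + gaussMod r + gaussMod s = 0 := by
  have key (p q r s) : gaussMat p q r s ∈ Xi12 ↔ p * s - q * r = 1 ∧
      gaussMod p + gaussMod q + gaussMod r + gaussMod s = 0 := by
    simp only [Xi12, Set.mem_ofPred_eq, isGauss_gaussMat, implies_true, true_and, det_gaussMat]
    refine and_congr_right fun h => ?_
    rw [zmod_two_sum_eq_zero _ _ _ _ (by simpa using congrArg gaussMod h)]
    simp [gaussMat, gCong_one_iff, gCong_zero_iff]
  constructor
  · intro h
    obtain ⟨p, q, r, s, rfl⟩ := eq_gaussMat h.1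
    exact ⟨p, q, r, s, rfl, (key _ _ _ _).1 h⟩
  · rintro ⟨p, q, r, s, rfl, h⟩
    exact (key _ _ _ _).2 h

lemma mem_Xi2_iff (g : Matrix (Fin 2) (Fin 2) ℂ) :
    g ∈ Xi2 ↔ ∃ p q r s, g = gaussMat p q r s ∧ p * s - q * r = 1 ∧
      gaussMod p = 1 ∧ gaussMod r = 1 := by
  have key (p q r s) : gaussMat p q r s ∈ Xi2 ↔ p * s - q * r = 1 ∧
      gaussMod p = 1 ∧ gaussMod r = 1 := by
    simp only [Xi2, Set.mem_ofPred_eq, isGauss_gaussMat, implies_true, true_and, det_gaussMat]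
    refine and_congr_right fun h => ?_
    rw [zmod_two_fst_col _ _ _ _ (by simpa using congrArg gaussMod h)]
    simp [gaussMat, gCong_one_iff, gCong_zero_iff]
  constructor
  · intro h
    obtain ⟨p, q, r, s, rfl⟩ := eq_gaussMat h.1
    exact ⟨p, q, r, s, rfl, (key _ _ _ _).1 h⟩
  · rintro ⟨p, q, r, s, rfl, h⟩
    exact (key _ _ _ _).2 h

lemma omega8_sq : omega8 ^ 2 = Complex.I := by
  have h : ((Real.sqrt 2 : ℝ) : ℂ) ^ 2 = 2 := by
    rw [← Complex.ofReal_pow, Real.sq_sqrt zero_le_two]; simp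
  rw [omega8, div_pow, h]
  linear_combination Complex.I_sq / 2

lemma omega8_ne_zero : omega8 ≠ 0 := by
  intro h
  have := omega8_sq
  simp [h, eq_comm] at this

lemma one_add_I_sq : (1 + Complex.I) ^ 2 = 2 * Complex.I := by
  linear_combination Complex.I_sq

lemma one_add_I_ne_zero : 1 + Complex.I ≠ 0 := by
  intro h
  have := one_add_I_sq
  simp [h] at this

/-- A complex vector whose pairwise products are half Gaussian integers is a multiple of a
primitive Gaussian vector. -/
lemma exists_primitive_multiple {ι : Type*} [Fintype ι] (w : ι → ℂ) (k : ι) (hk : w k ≠ 0)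
    (hw : ∀ i j, ∃ x : GaussianInt, (x : ℂ) = 2 * (w i * w j)) :
    ∃ (τ : ℂ) (T : GaussianInt) (v u : ι → GaussianInt),
      (∀ i, w i = τ * v i) ∧ (T : ℂ) = 2 * τ ^ 2 ∧ ∑ i, u i * v i = 1 := by
  choose X hX using hw
  obtain ⟨h, hh⟩ := (IsPrincipalIdealRing.principal (Ideal.span (Set.range (X k)))).principal
  have hdvd (j) : ∃ y, X k j = h * y := by
    have : X k j ∈ Ideal.span (Set.range (X k)) := Ideal.subset_span ⟨j, rfl⟩
    rw [hh] at this
    exact Ideal.mem_span_singleton.1 this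
  choose v hv using hdvd
  have hmem : h ∈ Ideal.span (Set.range (X k)) := by
    rw [hh]; exact Submodule.mem_span_singleton_self h
  obtain ⟨u, hu⟩ := (Ideal.mem_span_range_iff_exists_fun).1 hmem
  have hkk : X k k ≠ 0 := by
    intro h0
    have := hX k k
    simp [h0, hk] at this
  have hne : h ≠ 0 := by
    rintro rfl
    exact hkk (by simpa using hv k)
  have huv : ∑ i, u i * v i = 1 := by
    apply mul_left_cancel₀ hne
    rw [Finset.mul_sum, mul_one, ← hu]
    refine Finset.sum_congr rfl fun i _ => ?_
    rw [hv, hu]; ring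
  have hτ (i) : w i = (h : ℂ) / (2 * w k) * v i := by
    have := hX k i
    rw [hv] at this
    field_simp
    rw [map_mul] at this
    linear_combination -this
  refine ⟨(h : ℂ) / (2 * w k), ∑ i, ∑ j, u i * u j * X i j, v, u, hτ, ?_, huv⟩
  have hsum : (h : ℂ) / (2 * w k) = ∑ i, (u i : ℂ) * w i := by
    have h1 : ∑ i, (u i : ℂ) * v i = 1 := by
      simpa only [map_sum, map_mul, map_one] using congrArg GaussianInt.toComplex huv
    rw [← mul_one ((h : ℂ) / (2 * w k)), ← h1, Finset.mul_sum]
    exact Finset.sum_congr rfl fun i _ => by rw [hτ i]; ring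
  rw [hsum, pow_two, Finset.sum_mul_sum, Finset.mul_sum]
  simp only [map_sum, map_mul, hX, Finset.mul_sum]
  exact Finset.sum_congr rfl fun i _ => Finset.sum_congr rfl fun j _ => by ring

lemma isGauss_I_mul (z : ℂ) : IsGauss (Complex.I * z) ↔ IsGauss z := by
  simp only [isGauss_iff]
  constructor
  · rintro ⟨x, hx⟩
    refine ⟨-gaussI * x, ?_⟩
    rw [map_mul, map_neg, toComplex_gaussI, hx]
    linear_combination -z * Complex.I_sq
  · rintro ⟨x, rfl⟩
    exact ⟨gaussI * x, by simp⟩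

lemma isGauss_div (x n : GaussianInt) (hn : n ≠ 0) : IsGauss ((x : ℂ) / n) ↔ n ∣ x := by
  have hn' : (n : ℂ) ≠ 0 := by rwa [Ne, GaussianInt.toComplex_eq_zero]
  rw [isGauss_iff]
  constructor
  · rintro ⟨y, hy⟩
    refine ⟨y, ?_⟩
    rw [← GaussianInt.toComplex_inj, map_mul, hy]
    field_simp
  · rintro ⟨y, rfl⟩
    refine ⟨y, ?_⟩
    rw [map_mul]
    field_simp

/-- The divisibility conditions expressing that `CMat (τ • !![p, q; r, s])` is integral,
where `T = 2 * τ ^ 2`. -/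
structure ConjIntegral (T p q r s : GaussianInt) : Prop where
  c00 : 4 ∣ T * (p ^ 2 - r ^ 2 + s ^ 2 - q ^ 2)
  c01 : 4 ∣ T * (p ^ 2 - r ^ 2 + q ^ 2 - s ^ 2)
  c02 : 2 ∣ T * (r * s - p * q)
  c10 : 4 ∣ T * (q ^ 2 + s ^ 2 - p ^ 2 - r ^ 2)
  c11 : 4 ∣ T * (p ^ 2 + r ^ 2 + q ^ 2 + s ^ 2)
  c12 : 2 ∣ T * (p * q + r * s)
  c20 : 2 ∣ T * (-(p * r) + q * s)
  c21 : 2 ∣ T * (p * r + q * s)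
  c22 : 2 ∣ T * (p * s + q * r)

lemma cMat_isGauss_iff {τ : ℂ} {T p q r s : GaussianInt} (hT : (T : ℂ) = 2 * τ ^ 2) :
    (∀ i j, IsGauss (CMat (τ • gaussMat p q r s) i j)) ↔ ConjIntegral T p q r s := by
  have h2 (z : ℂ) (x : GaussianInt) (h : z = x / (2 : GaussianInt)) : IsGauss z ↔ 2 ∣ x := by
    rw [h, isGauss_div _ _ two_ne_zero]
  have h4 (z : ℂ) (x : GaussianInt) (h : z = x / (4 : GaussianInt)) : IsGauss z ↔ 4 ∣ x := by
    rw [h, isGauss_div _ _ (by decide)]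
  rw [Fin.forall_fin_succ, Fin.forall_fin_two, Fin.forall_fin_succ, Fin.forall_fin_two,
    Fin.forall_fin_succ, Fin.forall_fin_two, Fin.forall_fin_succ, Fin.forall_fin_two]
  simp only [CMat, gaussMat, Matrix.smul_apply, Matrix.of_apply, Matrix.cons_val', Matrix.cons_val,
    smul_eq_mul, Fin.succ_zero_eq_one, Fin.succ_one_eq_two]
  rw [mul_div_assoc, mul_div_assoc, isGauss_I_mul, isGauss_I_mul, isGauss_I_mul, isGauss_I_mul,
    h4 _ (T * (p ^ 2 - r ^ 2 + s ^ 2 - q ^ 2)), h4 _ (T * (p ^ 2 - r ^ 2 + q ^ 2 - s ^ 2)),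
    h2 _ (T * (r * s - p * q)), h4 _ (T * (q ^ 2 + s ^ 2 - p ^ 2 - r ^ 2)),
    h4 _ (T * (p ^ 2 + r ^ 2 + q ^ 2 + s ^ 2)), h2 _ (T * (p * q + r * s)),
    h2 _ (T * (-(p * r) + q * s)), h2 _ (T * (p * r + q * s)), h2 _ (T * (p * s + q * r))]
  · constructor
    · rintro ⟨⟨h1, h2, h3⟩, ⟨h4, h5, h6⟩, h7, h8, h9⟩
      exact ⟨h1, h2, h3, h4, h5, h6, h7, h8, h9⟩
    · rintro ⟨h1, h2, h3, h4, h5, h6, h7, h8, h9⟩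
      exact ⟨⟨h1, h2, h3⟩, ⟨h4, h5, h6⟩, h7, h8, h9⟩
  all_goals
    simp only [map_mul, map_add, map_sub, map_neg, map_pow, map_ofNat, hT]
    ring

lemma gaussMod_eq_zero_of_two_dvd_mul {u z : GaussianInt} (hu : u ^ 4 = 1)
    (h : 2 ∣ u * (1 + gaussI) * z) : gaussMod z = 0 := by
  rw [gaussMod_eq_zero_iff]
  have h0 : (1 + gaussI : GaussianInt) ≠ 0 := by decide
  apply (mul_dvd_mul_iff_left h0).1
  obtain ⟨k, hk⟩ := h
  exact ⟨-gaussI * u ^ 3 * k, by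
    linear_combination u ^ 3 * hk - (1 + gaussI) * z * hu
      + u ^ 3 * k * two_eq_one_add_gaussI_sq⟩

lemma zmod_two_all_eq : ∀ p q r s : ZMod 2, p + r + q + s = 0 → p * q + r * s = 0 →
    p * r + q * s = 0 → p * s + q * r = 0 →
    (p = 0 ∧ q = 0 ∧ r = 0 ∧ s = 0) ∨ (p = 1 ∧ q = 1 ∧ r = 1 ∧ s = 1) := by
  decide

lemma gaussMod_sum_of_two_dvd {p q r s : GaussianInt}
    (h : 2 ∣ p ^ 2 + r ^ 2 + q ^ 2 + s ^ 2) :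
    gaussMod p + gaussMod q + gaussMod r + gaussMod s = 0 := by
  have h := gaussMod_of_two_dvd h
  simp only [map_add, map_pow] at h
  generalize gaussMod p = a at *
  generalize gaussMod q = b at *
  generalize gaussMod r = c at *
  generalize gaussMod s = d at *
  revert a b c d
  decide

lemma dvd_of_dvd_unit_mul {u n z : GaussianInt} (hu : u ^ 4 = 1) (h : n ∣ u * z) : n ∣ z := by
  obtain ⟨k, hk⟩ := h
  exact ⟨u ^ 3 * k, by linear_combination u ^ 3 * hk - z * hu⟩

/-- A primitive vector satisfying the off-diagonal congruences modulo `1 + i` has all its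
entries odd. -/
lemma all_odd {p q r s a b c d : GaussianInt} (hprim : a * p + b * q + c * r + d * s = 1)
    (h1 : gaussMod (p ^ 2 + r ^ 2 + q ^ 2 + s ^ 2) = 0) (h2 : gaussMod (p * q + r * s) = 0)
    (h3 : gaussMod (p * r + q * s) = 0) (h4 : gaussMod (p * s + q * r) = 0) :
    gaussMod p = 1 ∧ gaussMod q = 1 ∧ gaussMod r = 1 ∧ gaussMod s = 1 := by
  have hsq : ∀ x : ZMod 2, x ^ 2 = x := by decide
  simp only [map_add, map_mul, map_pow, hsq] at h1 h2 h3 h4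
  refine (zmod_two_all_eq _ _ _ _ h1 h2 h3 h4).resolve_left ?_
  rintro ⟨hp, hq, hr, hs⟩
  have := congrArg gaussMod hprim
  simp [hp, hq, hr, hs] at this

lemma not_conjIntegral_of_odd {u p q r s : GaussianInt} (hu : u ^ 4 = 1)
    (hdet : u * (1 + gaussI) * (p * s - q * r) = 2) (hp : gaussMod p = 1) (hq : gaussMod q = 1)
    (hr : gaussMod r = 1) (hs : gaussMod s = 1) :
    ¬ 4 ∣ u * (1 + gaussI) * (p ^ 2 + r ^ 2 + q ^ 2 + s ^ 2) := by
  obtain ⟨np, kp, mp, hp, hp2⟩ := exists_eq_of_gaussMod_eq_one hp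
  obtain ⟨nq, kq, mq, hq, hq2⟩ := exists_eq_of_gaussMod_eq_one hq
  obtain ⟨nr, kr, mr, hr, hr2⟩ := exists_eq_of_gaussMod_eq_one hr
  obtain ⟨ns, ks, ms, hs, hs2⟩ := exists_eq_of_gaussMod_eq_one hs
  rintro ⟨e, he⟩
  rw [hp2, hq2, hr2, hs2] at he
  have hN : gaussMod ((np + nr + nq + ns : ℤ) : GaussianInt) = 0 := by
    apply gaussMod_eq_zero_of_two_dvd_mul hu
    refine ⟨e - u * (1 + gaussI) * (1 + mp + mq + mr + ms), ?_⟩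
    apply mul_left_cancel₀ (two_ne_zero (α := GaussianInt))
    push_cast
    linear_combination he
  rw [map_intCast, ZMod.intCast_zmod_eq_zero_iff_dvd] at hN
  obtain ⟨N, hN⟩ := hN
  have hN' : (np : GaussianInt) + nr + nq + ns = 2 * N := by exact_mod_cast hN
  have hD : ∃ D, p * s - q * r = 2 * D := by
    subst hp hq hr hs
    refine ⟨(1 + gaussI) * (N - nq - nr)
      + gaussI * (np * ns - nq * nr)
      + kp * (1 + (1 + gaussI) * ns) + ks * (1 + (1 + gaussI) * np) + 2 * kp * ks
      - (kq * (1 + (1 + gaussI) * nr) + kr * (1 + (1 + gaussI) * nq) + 2 * kq * kr), ?_⟩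
    linear_combination (1 + gaussI) * hN' + (np * ns - nq * nr : GaussianInt) * gaussI_sq
  obtain ⟨D, hD⟩ := hD
  have h1 : u * (1 + gaussI) * D = 1 := by
    apply mul_left_cancel₀ (two_ne_zero (α := GaussianInt))
    linear_combination hdet - u * (1 + gaussI) * hD
  have h2 := congrArg gaussMod h1
  simp [show (1 + 1 : ZMod 2) = 0 from by decide] at h2

lemma factor_of_mul_eq_two {T D : GaussianInt} (h : T * D = 2) :
    ∃ u : GaussianInt, u ^ 4 = 1 ∧ (T = u ∨ T = u * (1 + gaussI) ∨ T = 2 * u) := by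
  have hn := congrArg Zsqrtd.norm h
  rw [Zsqrtd.norm_mul] at hn
  have hD : 0 ≤ D.norm := GaussianInt.norm_nonneg D
  have h2 : Zsqrtd.norm (2 : GaussianInt) = 4 := by decide
  rw [h2] at hn
  generalize D.norm = N at *
  clear h h2
  obtain ⟨x, y⟩ := T
  simp only [Zsqrtd.norm_def] at hn
  have hN : N ≠ 0 := by rintro rfl; simp at hn
  have hN1 : 1 ≤ N := by omega
  have hle : x * x + y * y ≤ 4 := by nlinarith [mul_self_nonneg x, mul_self_nonneg y]
  have hx1 : -2 ≤ x := by nlinarith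
  have hx2 : x ≤ 2 := by nlinarith
  have hy1 : -2 ≤ y := by nlinarith
  have hy2 : y ≤ 2 := by nlinarith
  clear hle
  interval_cases x <;> interval_cases y <;> first
    | (exfalso; omega)
    | exact ⟨1, by decide⟩
    | exact ⟨-1, by decide⟩
    | exact ⟨gaussI, by decide⟩
    | exact ⟨-gaussI, by decide⟩

lemma unit_cases {R : Type*} [CommRing R] [IsDomain R] {i u : R} (hi : i ^ 2 = -1)
    (hu : u ^ 4 = 1) : u = 1 ∨ u = -1 ∨ u = i ∨ u = -i := by
  have : (u - 1) * ((u + 1) * ((u - i) * (u + i))) = 0 := by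
    linear_combination hu - (u ^ 2 - 1) * hi
  rcases mul_eq_zero.1 this with h | h
  · exact .inl (sub_eq_zero.1 h)
  rcases mul_eq_zero.1 h with h | h
  · exact .inr (.inl (eq_neg_of_add_eq_zero_left h))
  rcases mul_eq_zero.1 h with h | h
  · exact .inr (.inr (.inl (sub_eq_zero.1 h)))
  · exact .inr (.inr (.inr (eq_neg_of_add_eq_zero_left h)))

lemma exists_gauss_of_pow_four {κ : ℂ} (h : κ ^ 4 = 1) :
    ∃ x : GaussianInt, (x : ℂ) = κ ∧ gaussMod x = 1 := by
  rcases unit_cases Complex.I_sq h with rfl | rfl | rfl | rfl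
  · exact ⟨1, by simp⟩
  · exact ⟨-1, by simp⟩
  · exact ⟨gaussI, by simp⟩
  · exact ⟨-gaussI, by simp⟩

lemma gaussI_pow_four : gaussI ^ 4 = 1 := by
  linear_combination (gaussI ^ 2 - 1) * gaussI_sq

lemma gaussI_pow_sq (n : ℕ) : (gaussI ^ n) ^ 2 = 1 ∨ (gaussI ^ n) ^ 2 = -1 := by
  rw [← pow_mul, mul_comm, pow_mul, gaussI_sq]
  exact neg_one_pow_eq_or _ _

lemma smul_gaussMat (x p q r s : GaussianInt) :
    (x : ℂ) • gaussMat p q r s = gaussMat (x * p) (x * q) (x * r) (x * s) := by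
  simp [gaussMat]

lemma det_smul_gaussMat (τ : ℂ) (p q r s : GaussianInt) :
    (τ • gaussMat p q r s).det = τ ^ 2 * (p * s - q * r : GaussianInt) := by
  rw [Matrix.det_smul, gaussMat, Matrix.det_fin_two_of]
  simp

lemma mem_sixSet_inl_iff (δ : Fin 2) (g : Matrix (Fin 2) (Fin 2) ℂ) :
    g ∈ sixSet (.inl δ) ↔ ∃ p q r s, p * s - q * r = 1 ∧
      gaussMod p + gaussMod q + gaussMod r + gaussMod s = 0 ∧
      omega8 ^ (δ : ℕ) • g =
        gaussMat (gaussI ^ (δ : ℕ) * p) q (gaussI ^ (δ : ℕ) * r) s := by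
  have hω : omega8 ^ (δ : ℕ) ≠ 0 := pow_ne_zero _ omega8_ne_zero
  have hm (p q r s) : gaussMat p q r s * !![Complex.I ^ (δ : ℕ), 0; 0, 1] =
      gaussMat (gaussI ^ (δ : ℕ) * p) q (gaussI ^ (δ : ℕ) * r) s := by
    simp [gaussMat, mul_comm]
  simp only [sixSet, Set.mem_image, mem_Xi12_iff]
  constructor
  · rintro ⟨_, ⟨p, q, r, s, rfl, hdet, hsum⟩, rfl⟩
    exact ⟨p, q, r, s, hdet, hsum, by rw [hm, smul_inv_smul₀ hω]⟩
  · rintro ⟨p, q, r, s, hdet, hsum, h⟩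
    exact ⟨_, ⟨p, q, r, s, rfl, hdet, hsum⟩, by rw [hm, ← h, inv_smul_smul₀ hω]⟩

lemma mem_sixSet_inr_iff (δ ε : Fin 2) (g : Matrix (Fin 2) (Fin 2) ℂ) :
    g ∈ sixSet (.inr (δ, ε)) ↔ ∃ p q r s, p * s - q * r = 1 ∧ gaussMod p = 1 ∧ gaussMod r = 1 ∧
      (omega8 ^ (δ : ℕ) * (1 + Complex.I)) • g =
        gaussMat (gaussI ^ (1 + (δ : ℕ)) * p) (gaussI ^ (ε : ℕ) * p + 2 * q)
          (gaussI ^ (1 + (δ : ℕ)) * r) (gaussI ^ (ε : ℕ) * r + 2 * s) := by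
  have hω : omega8 ^ (δ : ℕ) * (1 + Complex.I) ≠ 0 :=
    mul_ne_zero (pow_ne_zero _ omega8_ne_zero) one_add_I_ne_zero
  have hm (p q r s) : gaussMat p q r s *
      !![Complex.I ^ (1 + (δ : ℕ)), Complex.I ^ (ε : ℕ); 0, 2] =
        gaussMat (gaussI ^ (1 + (δ : ℕ)) * p) (gaussI ^ (ε : ℕ) * p + 2 * q)
          (gaussI ^ (1 + (δ : ℕ)) * r) (gaussI ^ (ε : ℕ) * r + 2 * s) := by
    simp [gaussMat, mul_comm, map_ofNat]
  simp only [sixSet, Set.mem_image, mem_Xi2_iff]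
  constructor
  · rintro ⟨_, ⟨p, q, r, s, rfl, hdet, hp, hr⟩, rfl⟩
    exact ⟨p, q, r, s, hdet, hp, hr, by rw [hm, smul_inv_smul₀ hω]⟩
  · rintro ⟨p, q, r, s, hdet, hp, hr, h⟩
    exact ⟨_, ⟨p, q, r, s, rfl, hdet, hp, hr⟩, by rw [hm, ← h, inv_smul_smul₀ hω]⟩

lemma conjIntegral_of_even {T p q r s : GaussianInt}
    (h : gaussMod p + gaussMod q + gaussMod r + gaussMod s = 0) : ConjIntegral (2 * T) p q r s := by
  have h' : gaussMod (p + q + r + s) = 0 := by simpa using h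
  obtain ⟨k, hk⟩ := two_dvd_sq h'
  refine ⟨?_, ?_, ⟨_, mul_assoc _ _ _⟩, ?_, ?_, ⟨_, mul_assoc _ _ _⟩, ⟨_, mul_assoc _ _ _⟩,
    ⟨_, mul_assoc _ _ _⟩, ⟨_, mul_assoc _ _ _⟩⟩
  · exact ⟨T * (k - p * q - p * r - p * s - q * r - q * s - r * s - r ^ 2 - q ^ 2), by
      linear_combination 2 * T * hk⟩
  · exact ⟨T * (k - p * q - p * r - p * s - q * r - q * s - r * s - r ^ 2 - s ^ 2), by
      linear_combination 2 * T * hk⟩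
  · exact ⟨T * (k - p * q - p * r - p * s - q * r - q * s - r * s - p ^ 2 - r ^ 2), by
      linear_combination 2 * T * hk⟩
  · exact ⟨T * (k - p * q - p * r - p * s - q * r - q * s - r * s), by
      linear_combination 2 * T * hk⟩

lemma conjIntegral_of_odd {T p q r s a b : GaussianInt} (hp : gaussMod p = 1)
    (hr : gaussMod r = 1) (ha : a ^ 2 = 1 ∨ a ^ 2 = -1) (hb : b ^ 2 = 1 ∨ b ^ 2 = -1) :
    ConjIntegral T (a * p) (b * p + 2 * q) (a * r) (b * r + 2 * s) := by
  obtain ⟨k, hk⟩ := two_dvd_sq_sub_one hp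
  obtain ⟨l, hl⟩ := two_dvd_sq_sub_one hr
  obtain ⟨c, hc⟩ : ∃ c, a ^ 2 = b ^ 2 + 2 * c := by
    rcases ha with ha | ha <;> rcases hb with hb | hb <;> rw [ha, hb]
    exacts [⟨0, by ring⟩, ⟨1, by ring⟩, ⟨-1, by ring⟩, ⟨0, by ring⟩]
  constructor
  · exact ⟨T * (c * (k - l) + b * r * s + s ^ 2 - b * p * q - q ^ 2), by
      linear_combination T * (p ^ 2 - r ^ 2) * hc + 2 * T * c * (hk - hl)⟩
  · exact ⟨T * ((b ^ 2 + c) * (k - l) - b * r * s - s ^ 2 + b * p * q + q ^ 2), by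
      linear_combination T * (p ^ 2 - r ^ 2) * hc + 2 * T * (b ^ 2 + c) * (hk - hl)⟩
  · exact ⟨T * a * (b * (l - k) + r * s - p * q), by
      linear_combination T * a * b * (hl - hk)⟩
  · exact ⟨T * (-c * (1 + k + l) + b * r * s + s ^ 2 + b * p * q + q ^ 2), by
      linear_combination -T * (p ^ 2 + r ^ 2) * hc - 2 * T * c * (hk + hl)⟩
  · exact ⟨T * ((b ^ 2 + c) * (1 + k + l) + b * r * s + s ^ 2 + b * p * q + q ^ 2), by
      linear_combination T * (p ^ 2 + r ^ 2) * hc + 2 * T * (b ^ 2 + c) * (hk + hl)⟩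
  · exact ⟨T * a * (b * (1 + l + k) + r * s + p * q), by
      linear_combination T * a * b * (hl + hk)⟩
  · exact ⟨T * (-c * p * r + b * p * s + b * q * r + 2 * q * s), by
      linear_combination -T * p * r * hc⟩
  · exact ⟨T * ((b ^ 2 + c) * p * r + b * p * s + b * q * r + 2 * q * s), by
      linear_combination T * p * r * hc⟩
  · exact ⟨T * a * (b * p * r + p * s + q * r), by ring⟩

lemma smul_eq_gaussMat_mem_GammaSet {κ : ℂ} {T p q r s : GaussianInt}
    {g : Matrix (Fin 2) (Fin 2) ℂ} (hg : κ • g = gaussMat p q r s)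
    (hT : κ ^ 2 * T = 2) (hdet : T * (p * s - q * r) = 2) (h : ConjIntegral T p q r s) :
    g ∈ GammaSet := by
  have hκ : κ ≠ 0 := by rintro rfl; simp at hT
  have hT' : (T : ℂ) = 2 * κ⁻¹ ^ 2 := by
    field_simp
    linear_combination hT
  rw [← eq_inv_smul_iff₀ hκ] at hg
  subst hg
  refine ⟨?_, (cMat_isGauss_iff hT').2 h⟩
  have hdet' := congrArg GaussianInt.toComplex hdet
  rw [map_mul, hT', map_ofNat] at hdet'
  rw [det_smul_gaussMat]
  linear_combination hdet' / 2

lemma omega8_pow_sq (n : ℕ) : (omega8 ^ n) ^ 2 = Complex.I ^ n := by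
  rw [← pow_mul, mul_comm, pow_mul, omega8_sq]

lemma omega8_pow_pow_four (n : ℕ) : (omega8 ^ n) ^ 4 = (-1) ^ n := by
  rw [show 4 = 2 * 2 from rfl, pow_mul, omega8_pow_sq, ← pow_mul, mul_comm, pow_mul, Complex.I_sq]

lemma I_pow_mul_gaussI_pow (n : ℕ) :
    Complex.I ^ n * ((gaussI ^ (3 * n) : GaussianInt) : ℂ) = 1 := by
  rw [map_pow, toComplex_gaussI, ← pow_add, show n + 3 * n = 4 * n by ring, pow_mul,
    Complex.I_pow_four, one_pow]

lemma gaussI_pow_mul_gaussI_pow (n : ℕ) : gaussI ^ n * gaussI ^ (3 * n) = 1 := by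
  rw [← pow_add, show n + 3 * n = 4 * n by ring, pow_mul, gaussI_pow_four, one_pow]

lemma sixSet_subset_GammaSet (k) : sixSet k ⊆ GammaSet := by
  intro g hg
  rcases k with δ | ⟨δ, ε⟩
  · obtain ⟨p, q, r, s, hdet, hsum, h⟩ := (mem_sixSet_inl_iff _ _).1 hg
    have hdet' : gaussI ^ (3 * (δ : ℕ)) *
        (gaussI ^ (δ : ℕ) * p * s - q * (gaussI ^ (δ : ℕ) * r)) = 1 := by
      linear_combination gaussI ^ (δ : ℕ) * gaussI ^ (3 * (δ : ℕ)) * hdet +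
        gaussI_pow_mul_gaussI_pow δ
    refine smul_eq_gaussMat_mem_GammaSet h (T := 2 * gaussI ^ (3 * (δ : ℕ))) ?_ ?_
      (conjIntegral_of_even ?_)
    · rw [omega8_pow_sq, map_mul, map_ofNat]
      linear_combination 2 * I_pow_mul_gaussI_pow δ
    · linear_combination 2 * hdet'
    · simpa using hsum
  · obtain ⟨p, q, r, s, hdet, hp, hr, h⟩ := (mem_sixSet_inr_iff _ _ _).1 hg
    refine smul_eq_gaussMat_mem_GammaSet h (T := gaussI ^ (3 * (1 + (δ : ℕ)))) ?_ ?_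
      (conjIntegral_of_odd hp hr (gaussI_pow_sq _) (gaussI_pow_sq _))
    · rw [mul_pow, omega8_pow_sq, one_add_I_sq]
      linear_combination 2 * I_pow_mul_gaussI_pow (1 + δ)
    · linear_combination 2 * gaussI ^ (1 + (δ : ℕ)) * gaussI ^ (3 * (1 + (δ : ℕ))) * hdet +
        2 * gaussI_pow_mul_gaussI_pow (1 + δ)

lemma exists_neg_one_pow_mul_sq {u : GaussianInt} (hu : u ^ 4 = 1) (n : ℕ) :
    ∃ δ : Fin 2, (-1) ^ (n + (δ : ℕ)) * u ^ 2 = 1 := by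
  have h : u ^ 2 = 1 ∨ u ^ 2 = -1 := mul_self_eq_one_iff.1 (by linear_combination hu)
  rcases neg_one_pow_eq_or GaussianInt n with hn | hn <;> rcases h with h | h <;>
    simp [Fin.exists_fin_two, pow_add, hn, h]

lemma exists_two_dvd_sub {p q : GaussianInt} (hp : gaussMod p = 1) (hq : gaussMod q = 1) (n : ℕ) :
    ∃ ε : Fin 2, 2 ∣ q - gaussI ^ (ε + n : ℕ) * p := by
  induction n with
  | zero =>
    obtain ⟨m, k, -, hp, -⟩ := exists_eq_of_gaussMod_eq_one hp
    obtain ⟨n, l, -, hq, -⟩ := exists_eq_of_gaussMod_eq_one hq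
    subst hp hq
    rcases Int.even_or_odd' (n - m) with ⟨j, hj | hj⟩
    · have hj' : (n : GaussianInt) - m = 2 * j := by exact_mod_cast hj
      exact ⟨0, (1 + gaussI) * j + l - k, by
        simp only [Fin.val_zero, add_zero, pow_zero]
        linear_combination (1 + gaussI) * hj'⟩
    · have hj' : (n : GaussianInt) - m = 2 * j + 1 := by exact_mod_cast hj
      exact ⟨1, (1 + gaussI) * j + 1 + m + l - gaussI * k, by
        simp only [Fin.val_one, add_zero, pow_one]
        linear_combination (1 + gaussI) * hj' - m * gaussI_sq⟩
  | succ n ih =>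
    obtain ⟨ε, k, hk⟩ := ih
    fin_cases ε
    · exact ⟨1, k + gaussI ^ n * p, by
        simp only [Fin.val_one, pow_add, pow_zero, pow_one] at hk ⊢
        linear_combination hk - gaussI ^ n * p * gaussI_sq⟩
    · exact ⟨0, k, by
        simp only [Fin.val_zero, pow_add, pow_zero, pow_one] at hk ⊢
        linear_combination hk⟩

lemma mem_sixSet_inl_of_eq_smul {τ : ℂ} {u p q r s : GaussianInt} (hu : u ^ 4 = 1)
    (hτ : (u : ℂ) = τ ^ 2) (hdet : u * (p * s - q * r) = 1)
    (hsum : gaussMod p + gaussMod q + gaussMod r + gaussMod s = 0) :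
    ∃ δ, τ • gaussMat p q r s ∈ sixSet (.inl δ) := by
  obtain ⟨δ, hδ⟩ := exists_neg_one_pow_mul_sq hu 0
  have hδ' := congrArg GaussianInt.toComplex hδ
  rw [zero_add, map_mul, map_pow, map_pow, map_neg, map_one, hτ] at hδ'
  obtain ⟨x, hx, hx1⟩ : ∃ x : GaussianInt, (x : ℂ) = omega8 ^ (δ : ℕ) * τ ∧ gaussMod x = 1 := by
    apply exists_gauss_of_pow_four
    rw [mul_pow, omega8_pow_pow_four]
    linear_combination hδ'
  have hx2 : x ^ 2 = gaussI ^ (δ : ℕ) * u := by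
    rw [← GaussianInt.toComplex_inj, map_pow, hx, mul_pow, omega8_pow_sq, map_mul, hτ, map_pow,
      toComplex_gaussI]
  have hi := gaussI_pow_mul_gaussI_pow δ
  refine ⟨δ, (mem_sixSet_inl_iff _ _).2 ⟨gaussI ^ (3 * (δ : ℕ)) * x * p, x * q,
    gaussI ^ (3 * (δ : ℕ)) * x * r, x * s, ?_, by simpa [hx1] using hsum, ?_⟩⟩
  · linear_combination gaussI ^ (3 * (δ : ℕ)) * (p * s - q * r) * hx2 +
      gaussI ^ (δ : ℕ) * gaussI ^ (3 * (δ : ℕ)) * hdet + hi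
  · rw [smul_smul, ← hx, smul_gaussMat]
    congr 1
    · linear_combination -x * p * hi
    · linear_combination -x * r * hi

lemma mem_sixSet_inr_of_eq_smul {τ : ℂ} {u p q r s : GaussianInt} (hu : u ^ 4 = 1)
    (hτ : (u : ℂ) = 2 * τ ^ 2) (hdet : u * (p * s - q * r) = 2)
    (hp : gaussMod p = 1) (hq : gaussMod q = 1) (hr : gaussMod r = 1) :
    ∃ δ ε, τ • gaussMat p q r s ∈ sixSet (.inr (δ, ε)) := by
  obtain ⟨δ, hδ⟩ := exists_neg_one_pow_mul_sq hu 1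
  have hδ' := congrArg GaussianInt.toComplex hδ
  rw [map_mul, map_pow, map_pow, map_neg, map_one, hτ] at hδ'
  obtain ⟨x, hx, hx1⟩ : ∃ x : GaussianInt,
      (x : ℂ) = omega8 ^ (δ : ℕ) * (1 + Complex.I) * τ ∧ gaussMod x = 1 := by
    apply exists_gauss_of_pow_four
    rw [pow_add] at hδ'
    have h4 : (1 + Complex.I) ^ 4 = -4 := by
      linear_combination ((1 + Complex.I) ^ 2 + 2 * Complex.I) * one_add_I_sq + 4 * Complex.I_sq
    rw [mul_pow, mul_pow, omega8_pow_pow_four, h4]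
    linear_combination hδ'
  have hx2 : x ^ 2 = gaussI ^ (1 + (δ : ℕ)) * u := by
    rw [← GaussianInt.toComplex_inj, map_pow, hx, mul_pow, mul_pow, omega8_pow_sq, one_add_I_sq,
      map_mul, hτ, map_pow, toComplex_gaussI]
    ring
  have hi := gaussI_pow_mul_gaussI_pow (1 + δ)
  obtain ⟨ε, k, hk⟩ := exists_two_dvd_sub hp hq (3 * (1 + δ))
  rw [pow_add] at hk
  have hdet2 : p * s - q * r = 2 * u ^ 3 := by
    linear_combination u ^ 3 * hdet - (p * s - q * r) * hu
  obtain ⟨l, hl⟩ : 2 ∣ s - gaussI ^ (ε : ℕ) * gaussI ^ (3 * (1 + (δ : ℕ))) * r := by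
    obtain ⟨m, hm⟩ := two_dvd_sq_sub_one hp
    exact ⟨p * (u ^ 3 + k * r)
      - m * (s - gaussI ^ (ε : ℕ) * gaussI ^ (3 * (1 + (δ : ℕ))) * r), by
      linear_combination p * hdet2 + p * r * hk
        - (s - gaussI ^ (ε : ℕ) * gaussI ^ (3 * (1 + (δ : ℕ))) * r) * hm⟩
  set j := gaussI ^ (3 * (1 + (δ : ℕ))) with hj
  refine ⟨δ, ε, (mem_sixSet_inr_iff _ _ _).2 ⟨j * x * p, x * k, j * x * r, x * l, ?_,
    by simp [hj, hx1, hp], by simp [hj, hx1, hr], ?_⟩⟩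
  · apply mul_left_cancel₀ (two_ne_zero (α := GaussianInt))
    linear_combination j * (p * s - q * r) * hx2 + gaussI ^ (1 + (δ : ℕ)) * j * hdet + 2 * hi
      - j * x ^ 2 * (p * hl - r * hk)
  · rw [smul_smul, ← hx, smul_gaussMat]
    congr 1
    · linear_combination -x * p * hi
    · linear_combination x * hk
    · linear_combination -x * r * hi
    · linear_combination x * hl

lemma exists_gauss_eq_two_mul {g : Matrix (Fin 2) (Fin 2) ℂ} (hg : g ∈ GammaSet)
    (i j : Fin 4) : ∃ x : GaussianInt, (x : ℂ) = 2 *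
      (![g 0 0, g 0 1, g 1 0, g 1 1] i * ![g 0 0, g 0 1, g 1 0, g 1 1] j) := by
  obtain ⟨hdet, hC⟩ := hg
  rw [Matrix.det_fin_two] at hdet
  simp only [isGauss_iff] at hC
  choose X hX using hC
  have h00 := hX 0 0
  have h01 := hX 0 1
  have h02 := hX 0 2
  have h10 := hX 1 0
  have h11 := hX 1 1
  have h12 := hX 1 2
  have h20 := hX 2 0
  have h21 := hX 2 1
  have h22 := hX 2 2
  simp only [CMat, Matrix.of_apply, Matrix.cons_val', Matrix.cons_val]
    at h00 h01 h02 h10 h11 h12 h20 h21 h22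
  generalize g 0 0 = a at *
  generalize g 0 1 = b at *
  generalize g 1 0 = c at *
  generalize g 1 1 = d at *
  clear hX
  have haa : ∃ x : GaussianInt, (x : ℂ) = 2 * (a * a) :=
    ⟨X 0 0 + X 1 1 + gaussI * (X 1 0 - X 0 1), by
      simp only [map_add, map_sub, map_mul, toComplex_gaussI, h00, h01, h10, h11]
      linear_combination (b ^ 2 + d ^ 2 - a ^ 2 - c ^ 2 - (a ^ 2 - c ^ 2 + b ^ 2 - d ^ 2)) / 2
        * Complex.I_sq⟩
  have hdd : ∃ x : GaussianInt, (x : ℂ) = 2 * (d * d) :=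
    ⟨X 0 0 + X 1 1 - gaussI * (X 1 0 - X 0 1), by
      simp only [map_add, map_sub, map_mul, toComplex_gaussI, h00, h01, h10, h11]
      linear_combination -(b ^ 2 + d ^ 2 - a ^ 2 - c ^ 2 - (a ^ 2 - c ^ 2 + b ^ 2 - d ^ 2)) / 2
        * Complex.I_sq⟩
  have hbb : ∃ x : GaussianInt, (x : ℂ) = 2 * (b * b) :=
    ⟨X 1 1 - X 0 0 - gaussI * (X 1 0 + X 0 1), by
      simp only [map_add, map_sub, map_mul, toComplex_gaussI, h00, h01, h10, h11]
      linear_combination -(b ^ 2 + d ^ 2 - a ^ 2 - c ^ 2 + (a ^ 2 - c ^ 2 + b ^ 2 - d ^ 2)) / 2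
        * Complex.I_sq⟩
  have hcc : ∃ x : GaussianInt, (x : ℂ) = 2 * (c * c) :=
    ⟨X 1 1 - X 0 0 + gaussI * (X 1 0 + X 0 1), by
      simp only [map_add, map_sub, map_mul, toComplex_gaussI, h00, h01, h10, h11]
      linear_combination (b ^ 2 + d ^ 2 - a ^ 2 - c ^ 2 + (a ^ 2 - c ^ 2 + b ^ 2 - d ^ 2)) / 2
        * Complex.I_sq⟩
  have hab : ∃ x : GaussianInt, (x : ℂ) = 2 * (a * b) :=
    ⟨-X 0 2 - gaussI * X 1 2, by
      simp only [map_neg, map_sub, map_mul, toComplex_gaussI, h02, h12]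
      linear_combination -(a * b + c * d) * Complex.I_sq⟩
  have hcd : ∃ x : GaussianInt, (x : ℂ) = 2 * (c * d) :=
    ⟨X 0 2 - gaussI * X 1 2, by
      simp only [map_sub, map_mul, toComplex_gaussI, h02, h12]
      linear_combination -(a * b + c * d) * Complex.I_sq⟩
  have hac : ∃ x : GaussianInt, (x : ℂ) = 2 * (a * c) :=
    ⟨-X 2 0 - gaussI * X 2 1, by
      simp only [map_neg, map_sub, map_mul, toComplex_gaussI, h20, h21]
      linear_combination -(a * c + b * d) * Complex.I_sq⟩
  have hbd : ∃ x : GaussianInt, (x : ℂ) = 2 * (b * d) :=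
    ⟨X 2 0 - gaussI * X 2 1, by
      simp only [map_sub, map_mul, toComplex_gaussI, h20, h21]
      linear_combination -(a * c + b * d) * Complex.I_sq⟩
  have had : ∃ x : GaussianInt, (x : ℂ) = 2 * (a * d) :=
    ⟨X 2 2 + 1, by
      rw [map_add, map_one, h22]
      linear_combination -hdet⟩
  have hbc : ∃ x : GaussianInt, (x : ℂ) = 2 * (b * c) :=
    ⟨X 2 2 - 1, by
      rw [map_sub, map_one, h22]
      linear_combination hdet⟩
  have hcomm (y z : ℂ) (h : ∃ x : GaussianInt, (x : ℂ) = 2 * (y * z)) :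
      ∃ x : GaussianInt, (x : ℂ) = 2 * (z * y) := by rwa [mul_comm z]
  fin_cases i <;> fin_cases j <;> first | assumption | (apply hcomm; assumption)

lemma exists_mem_sixSet {g : Matrix (Fin 2) (Fin 2) ℂ} (hg : g ∈ GammaSet) :
    ∃ k, g ∈ sixSet k := by
  have hprod := exists_gauss_eq_two_mul hg
  obtain ⟨k, hk⟩ : ∃ k, ![g 0 0, g 0 1, g 1 0, g 1 1] k ≠ 0 := by
    by_contra! h
    have h0 : g 0 0 = 0 := h 0
    have h1 : g 0 1 = 0 := h 1
    have := hg.1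
    simp [Matrix.det_fin_two, h0, h1] at this
  obtain ⟨τ, T, v, u, hv, hT, huv⟩ := exists_primitive_multiple _ k hk hprod
  generalize hp : v 0 = p at *
  generalize hq : v 1 = q at *
  generalize hr : v 2 = r at *
  generalize hs : v 3 = s at *
  have hgM : g = τ • gaussMat p q r s := by
    have h0 := hv 0
    have h1 := hv 1
    have h2 := hv 2
    have h3 := hv 3
    simp only [Matrix.cons_val, hp, hq, hr, hs] at h0 h1 h2 h3
    ext i j
    fin_cases i <;> fin_cases j <;> simp [gaussMat, h0, h1, h2, h3]
  rw [Fin.sum_univ_four, hp, hq, hr, hs] at huv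
  obtain ⟨hdet, hC⟩ := hg
  subst hgM
  rw [det_smul_gaussMat] at hdet
  have hD : T * (p * s - q * r) = 2 := by
    rw [← GaussianInt.toComplex_inj, map_mul, hT, map_ofNat]
    linear_combination 2 * hdet
  replace hC := (cMat_isGauss_iff hT).1 hC
  obtain ⟨w, hw, hTw⟩ := factor_of_mul_eq_two hD
  have h24 : (2 : GaussianInt) ∣ 4 := ⟨2, by norm_num⟩
  rcases hTw with rfl | rfl | rfl
  · have hodd := all_odd huv
      (gaussMod_of_two_dvd (dvd_of_dvd_unit_mul hw (h24.trans hC.c11)))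
      (gaussMod_of_two_dvd (dvd_of_dvd_unit_mul hw hC.c12))
      (gaussMod_of_two_dvd (dvd_of_dvd_unit_mul hw hC.c21))
      (gaussMod_of_two_dvd (dvd_of_dvd_unit_mul hw hC.c22))
    obtain ⟨δ, ε, h⟩ := mem_sixSet_inr_of_eq_smul hw hT hD hodd.1 hodd.2.1 hodd.2.2.1
    exact ⟨_, h⟩
  · have hodd := all_odd huv
      (gaussMod_eq_zero_of_two_dvd_mul hw (h24.trans hC.c11))
      (gaussMod_eq_zero_of_two_dvd_mul hw hC.c12)
      (gaussMod_eq_zero_of_two_dvd_mul hw hC.c21)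
      (gaussMod_eq_zero_of_two_dvd_mul hw hC.c22)
    exact absurd hC.c11 (not_conjIntegral_of_odd hw hD hodd.1 hodd.2.1 hodd.2.2.1 hodd.2.2.2)
  · obtain ⟨e, he⟩ := hC.c11
    have hsq : 2 ∣ w * (p ^ 2 + r ^ 2 + q ^ 2 + s ^ 2) := ⟨e, by
      apply mul_left_cancel₀ (two_ne_zero (α := GaussianInt))
      linear_combination he⟩
    have hsum := gaussMod_sum_of_two_dvd (dvd_of_dvd_unit_mul hw hsq)
    obtain ⟨δ, h⟩ := mem_sixSet_inl_of_eq_smul (τ := τ) hw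
      (by rw [map_mul, map_ofNat] at hT; linear_combination hT / 2)
      (by
        apply mul_left_cancel₀ (two_ne_zero (α := GaussianInt))
        linear_combination hD) hsum
    exact ⟨_, h⟩

/-- The residues modulo `2` that tell the six sets apart. -/
def SixInvariant (g : Matrix (Fin 2) (Fin 2) ℂ) : Fin 2 ⊕ (Fin 2 × Fin 2) → Prop
  | .inl δ => (∃ x : GaussianInt, 2 * g 0 0 ^ 2 = (2 * x : GaussianInt)) ∧
      ∃ x : GaussianInt, g 0 0 ^ 2 + g 0 1 ^ 2 = (gaussI ^ (δ : ℕ) + 2 * x : GaussianInt)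
  | .inr (δ, ε) =>
      (∃ x : GaussianInt, 2 * g 0 0 ^ 2 = (gaussI * gaussI ^ (δ : ℕ) + 2 * x : GaussianInt)) ∧
      ∃ x : GaussianInt, 2 * (g 0 0 * g 0 1) = (gaussI ^ (ε : ℕ) + 2 * x : GaussianInt)

lemma two_dvd_sq_add_sq_sub_one {p q r s : GaussianInt} (h : p * s - q * r = 1)
    (hsum : gaussMod p + gaussMod q + gaussMod r + gaussMod s = 0) :
    2 ∣ p ^ 2 + q ^ 2 - 1 := by
  rcases (zmod_two_sum_eq_zero _ _ _ _ (by simpa using congrArg gaussMod h)).1 hsum with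
    ⟨hp, hq, -⟩ | ⟨hp, hq, -⟩
  · convert (two_dvd_sq_sub_one hp).add (two_dvd_sq hq) using 1
    ring
  · convert (two_dvd_sq hp).add (two_dvd_sq_sub_one hq) using 1
    ring

lemma sixInvariant_of_mem {g : Matrix (Fin 2) (Fin 2) ℂ} {k} (hg : g ∈ sixSet k) :
    SixInvariant g k := by
  rcases k with δ | ⟨δ, ε⟩
  · obtain ⟨p, q, r, s, hdet, hsum, h⟩ := (mem_sixSet_inl_iff _ _).1 hg
    obtain ⟨k, hk⟩ := two_dvd_sq_add_sq_sub_one hdet hsum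
    have hk' := congrArg GaussianInt.toComplex hk
    simp only [map_add, map_sub, map_mul, map_pow, map_one, map_ofNat] at hk'
    have h0 : omega8 ^ (δ : ℕ) * g 0 0 = _ := congrFun (congrFun h 0) 0
    have h1 : omega8 ^ (δ : ℕ) * g 0 1 = _ := congrFun (congrFun h 0) 1
    have hω := omega8_pow_sq δ
    simp only [gaussMat, Matrix.of_apply, Matrix.cons_val', Matrix.cons_val, map_mul, map_pow,
      toComplex_gaussI] at h0 h1
    fin_cases δ
    · simp only [pow_zero, one_mul] at h0 h1
      exact ⟨⟨p ^ 2, by simp [h0, map_ofNat]⟩, ⟨k, by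
        simp only [pow_zero, map_add, map_mul, map_one, map_ofNat, h0, h1]
        linear_combination hk'⟩⟩
    · simp only [pow_one] at h0 h1 hω
      have h0' : g 0 0 ^ 2 = Complex.I * p ^ 2 := by
        apply mul_left_cancel₀ Complex.I_ne_zero
        linear_combination (omega8 * g 0 0 + Complex.I * p) * h0 - g 0 0 ^ 2 * hω
      have h1' : g 0 1 ^ 2 = -Complex.I * q ^ 2 := by
        apply mul_left_cancel₀ Complex.I_ne_zero
        linear_combination (omega8 * g 0 1 + q) * h1 - g 0 1 ^ 2 * hω + q ^ 2 * Complex.I_sq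
      refine ⟨⟨gaussI * p ^ 2, ?_⟩, ⟨gaussI * (k - q ^ 2), ?_⟩⟩
      · simp [h0', map_ofNat]
      · simp only [pow_one, map_add, map_sub, map_mul, map_pow, map_ofNat,
          toComplex_gaussI, h0', h1']
        linear_combination Complex.I * hk'
  · obtain ⟨p, q, r, s, hdet, hp, hr, h⟩ := (mem_sixSet_inr_iff _ _ _).1 hg
    obtain ⟨k, hk⟩ := two_dvd_sq_sub_one hp
    have hk' := congrArg GaussianInt.toComplex hk
    simp only [map_sub, map_mul, map_pow, map_one, map_ofNat] at hk'
    have h0 : omega8 ^ (δ : ℕ) * (1 + Complex.I) * g 0 0 = _ := congrFun (congrFun h 0) 0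
    have h1 : omega8 ^ (δ : ℕ) * (1 + Complex.I) * g 0 1 = _ := congrFun (congrFun h 0) 1
    have hω : (omega8 ^ (δ : ℕ) * (1 + Complex.I)) ^ 2 = 2 * Complex.I ^ (1 + (δ : ℕ)) := by
      rw [mul_pow, omega8_pow_sq, one_add_I_sq]
      ring
    have hI : Complex.I ^ (1 + (δ : ℕ)) ≠ 0 := pow_ne_zero _ Complex.I_ne_zero
    simp only [gaussMat, Matrix.of_apply, Matrix.cons_val', Matrix.cons_val, map_mul, map_pow,
      map_add, map_ofNat, toComplex_gaussI] at h0 h1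
    generalize omega8 ^ (δ : ℕ) * (1 + Complex.I) = κ at *
    refine ⟨⟨gaussI * gaussI ^ (δ : ℕ) * k, ?_⟩, ⟨gaussI ^ (ε : ℕ) * k + p * q, ?_⟩⟩
    · simp only [map_add, map_mul, map_pow, map_ofNat, toComplex_gaussI]
      apply mul_left_cancel₀ hI
      linear_combination (κ * g 0 0 + Complex.I ^ (1 + (δ : ℕ)) * p) * h0 - g 0 0 ^ 2 * hω
        + (Complex.I ^ (1 + (δ : ℕ))) ^ 2 * hk'
    · simp only [map_add, map_mul, map_pow, map_ofNat, toComplex_gaussI]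
      apply mul_left_cancel₀ hI
      linear_combination κ * g 0 1 * h0 + Complex.I ^ (1 + (δ : ℕ)) * p * h1
        - g 0 0 * g 0 1 * hω + Complex.I ^ (1 + (δ : ℕ)) * Complex.I ^ (ε : ℕ) * hk'

lemma eq_of_gaussI_pow_add_eq {m n : Fin 2} {x y : GaussianInt}
    (h : gaussI ^ (m : ℕ) + 2 * x = gaussI ^ (n : ℕ) + 2 * y) : m = n := by
  have h := congrArg Zsqrtd.re h
  fin_cases m <;> fin_cases n <;> simp [gaussI] at h ⊢ <;> omega

lemma two_mul_ne_gaussI_pow_add (n : ℕ) (x y : GaussianInt) :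
    2 * x ≠ gaussI * gaussI ^ n + 2 * y := by
  intro h
  have h2 : gaussMod 2 = 0 := gaussMod_of_two_dvd dvd_rfl
  simpa [h2] using congrArg gaussMod h

lemma SixInvariant.unique {g : Matrix (Fin 2) (Fin 2) ℂ} {k l} (hk : SixInvariant g k)
    (hl : SixInvariant g l) : k = l := by
  rcases k with δ | ⟨δ, ε⟩ <;> rcases l with δ' | ⟨δ', ε'⟩ <;>
    obtain ⟨⟨x, hx⟩, y, hy⟩ := hk <;> obtain ⟨⟨x', hx'⟩, y', hy'⟩ := hl
  · rw [eq_of_gaussI_pow_add_eq (GaussianInt.toComplex_inj.1 (hy.symm.trans hy'))]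
  · exact absurd (GaussianInt.toComplex_inj.1 (hx.symm.trans hx')) (two_mul_ne_gaussI_pow_add _ _ _)
  · exact absurd (GaussianInt.toComplex_inj.1 (hx'.symm.trans hx)) (two_mul_ne_gaussI_pow_add _ _ _)
  · have h := GaussianInt.toComplex_inj.1 (hx.symm.trans hx')
    rw [eq_of_gaussI_pow_add_eq (GaussianInt.toComplex_inj.1 (hy.symm.trans hy')),
      eq_of_gaussI_pow_add_eq (m := δ) (n := δ') (x := -gaussI * x) (y := -gaussI * x')
        (by linear_combination -gaussI * h
              + (gaussI ^ (δ : ℕ) - gaussI ^ (δ' : ℕ)) * gaussI_sq)]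

/-- `Γ'` is the disjoint union of the six sets: a matrix `g ∈ SL(2,ℂ)` has all entries of
`C(g)` in `ℤ[i]` iff it lies in one of the six sets, and the six sets are pairwise
disjoint. -/
theorem stmt3 :
    (GammaSet = ⋃ k, sixSet k) ∧
      Pairwise fun k₁ k₂ => Disjoint (sixSet k₁) (sixSet k₂) := by
  refine ⟨Set.Subset.antisymm (fun g hg => Set.mem_iUnion.2 (exists_mem_sixSet hg))
    (Set.iUnion_subset sixSet_subset_GammaSet), fun k₁ k₂ hne => ?_⟩
  exact Set.disjoint_left.2 fun g h₁ h₂ =>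
    hne ((sixInvariant_of_mem h₁).unique (sixInvariant_of_mem h₂))
end
end

section
/- Let G be the group of affine transformations of ℂ of the form w ↦ i^k · w + c with k ∈ ℤ and c ∈ (1+i)·ℤ[i]. Then the closed triangle T is an exact fundamental domain for the action of G on ℂ: the images g(T), g ∈ G, cover ℂ, and for any two distinct elements g₁, g₂ ∈ G the intersection g₁(T) ∩ g₂(T) is contained in g₁(∂T) ∩ g₂(∂T), where ∂T denotes the topological frontier of T in ℂ. -/
open Complex

noncomputable section

/-- The closed triangle with vertices `1`, `2`, `1+i`. -/
def Tri : Set ℂ := convexHull ℝ ({1, 2, 1 + Complex.I} : Set ℂ)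

theorem mem_Tri_iff {z : ℂ} : z ∈ Tri ↔ 1 ≤ z.re ∧ 0 ≤ z.im ∧ z.re + z.im ≤ 2 := by
  rw [Tri, convexHull_insert (by simp), convexHull_pair]
  simp only [mem_convexJoin, Set.mem_singleton_iff, exists_eq_left]
  constructor
  · rintro ⟨w, ⟨a, b, ha, hb, hab, rfl⟩, c, d, hc, hd, hcd, rfl⟩
    have hda := mul_nonneg hd ha
    have hdb := mul_nonneg hd hb
    have h : d * a + d * b = d := by rw [← mul_add, hab, mul_one]
    simp
    refine ⟨?_, ?_, ?_⟩ <;> nlinarith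
  · rintro ⟨h1, h2, h3⟩
    rcases eq_or_lt_of_le (show 0 ≤ z.re - 1 + z.im by linarith) with h | h
    · refine ⟨2, left_mem_segment ℝ _ _, 1, 0, zero_le_one, le_rfl, by simp, ?_⟩
      apply Complex.ext <;> simp <;> linarith
    · obtain ⟨α, hα⟩ : ∃ α, α = (z.re - 1) / (z.re - 1 + z.im) := ⟨_, rfl⟩
      obtain ⟨β, hβ⟩ : ∃ β, β = z.im / (z.re - 1 + z.im) := ⟨_, rfl⟩
      have hα0 : 0 ≤ α := hα ▸ div_nonneg (by linarith) h.le
      have hβ0 : 0 ≤ β := hβ ▸ div_nonneg h2 h.le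
      rw [eq_div_iff h.ne'] at hα hβ
      have hαβ : α + β = 1 := mul_right_cancel₀ h.ne' (by linear_combination hα + hβ)
      refine ⟨α • (2 : ℂ) + β • (1 + Complex.I), ⟨α, β, hα0, hβ0, hαβ, rfl⟩,
        1 - (z.re - 1 + z.im), z.re - 1 + z.im, by linarith, h.le, by ring, ?_⟩
      apply Complex.ext <;> simp
      · linear_combination 2 * hα + hβ
      · linear_combination hβ

theorem lt_of_mem_interior_Tri {z : ℂ} (hz : z ∈ interior Tri) :
    1 < z.re ∧ 0 < z.im ∧ z.re + z.im < 2 := by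
  have key (v : ℂ) : ∃ t : ℝ, 0 < t ∧ z + t * v ∈ Tri := by
    have hc : Filter.Tendsto (fun t : ℝ => z + t * v) (nhds 0) (nhds z) := by
      have : Continuous fun t : ℝ => z + t * v := by fun_prop
      simpa using this.tendsto 0
    have he := hc.eventually (mem_interior_iff_mem_nhds.mp hz)
    obtain ⟨ε, hε, h⟩ := Metric.eventually_nhds_iff.mp he
    refine ⟨ε / 2, half_pos hε, h ?_⟩
    rw [Real.dist_eq, sub_zero, abs_of_pos (half_pos hε)]
    linarith
  obtain ⟨t, ht, h⟩ := key (-1 - Complex.I)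
  obtain ⟨s, hs, h'⟩ := key 1
  rw [mem_Tri_iff] at h h'
  simp at h h'
  refine ⟨?_, ?_, ?_⟩ <;> linarith

theorem isClosed_Tri : IsClosed Tri :=
  ((Set.toFinite _).isCompact_convexHull ℝ).isClosed

theorem I_zpow_cases (k : ℤ) : Complex.I ^ k = 1 ∨ Complex.I ^ k = Complex.I ∨
    Complex.I ^ k = -1 ∨ Complex.I ^ k = -Complex.I := by
  have h : Complex.I ^ k = Complex.I ^ (k % 4) := by
    conv_lhs => rw [← Int.mul_ediv_add_emod k 4, zpow_add₀ Complex.I_ne_zero, zpow_mul]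
    have : Complex.I ^ (4 : ℤ) = 1 := by exact_mod_cast Complex.I_pow_four
    rw [this, one_zpow, one_mul]
  rw [h]
  have h0 := Int.emod_nonneg k (show (4 : ℤ) ≠ 0 by norm_num)
  have h4 := Int.emod_lt_of_pos k (show (0 : ℤ) < 4 by norm_num)
  interval_cases k % 4
  · simp
  · simp
  · right; right; left; exact_mod_cast Complex.I_sq
  · right; right; right; exact_mod_cast Complex.I_pow_three

theorem gDvd_one_add_I_iff {c : ℂ} : GDvd (1 + Complex.I) c ↔
    ∃ a b : ℤ, c.re = a - b ∧ c.im = a + b := by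
  constructor
  · rintro ⟨_, ⟨a, b, rfl⟩, rfl⟩
    exact ⟨a, b, by simp, by simp; ring⟩
  · rintro ⟨a, b, h1, h2⟩
    refine ⟨_, ⟨a, b, rfl⟩, ?_⟩
    apply Complex.ext
    · simp [h1]
    · simp [h2]; ring

theorem GDvd.sub {m c d : ℂ} (hc : GDvd m c) (hd : GDvd m d) : GDvd m (c - d) := by
  obtain ⟨_, ⟨a, b, rfl⟩, rfl⟩ := hc
  obtain ⟨_, ⟨a', b', rfl⟩, rfl⟩ := hd
  exact ⟨_, ⟨a - a', b - b', rfl⟩, by push_cast; ring⟩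

theorem GDvd.I_zpow_mul {m c : ℂ} (hc : GDvd m c) (k : ℤ) : GDvd m (Complex.I ^ k * c) := by
  obtain ⟨_, ⟨a, b, rfl⟩, rfl⟩ := hc
  rcases I_zpow_cases k with h | h | h | h <;> rw [h]
  · exact ⟨_, ⟨a, b, rfl⟩, by ring⟩
  · exact ⟨_, ⟨-b, a, rfl⟩, by push_cast; linear_combination (m * b) * Complex.I_sq⟩
  · exact ⟨_, ⟨-a, -b, rfl⟩, by push_cast; ring⟩
  · exact ⟨_, ⟨b, -a, rfl⟩, by push_cast; linear_combination (-m * b) * Complex.I_sq⟩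

theorem int_eq_of_abs_sub_lt {n m : ℤ} (h1 : (m : ℝ) - 1 < n) (h2 : (n : ℝ) < m + 1) :
    n = m := by
  have h1' : m - 1 < n := by exact_mod_cast h1
  have h2' : n < m + 1 := by exact_mod_cast h2
  omega

/-- Only the identity of the group moves a point of `T` into the interior of `T`. -/
theorem eq_one_and_eq_zero_of_mem_interior_Tri {p q c : ℂ} {k : ℤ} (hp : p ∈ interior Tri)
    (hq : q ∈ Tri) (hc : GDvd (1 + Complex.I) c) (h : p = Complex.I ^ k * q + c) :
    Complex.I ^ k = 1 ∧ c = 0 := by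
  obtain ⟨p1, p2, p3⟩ := lt_of_mem_interior_Tri hp
  obtain ⟨q1, q2, q3⟩ := mem_Tri_iff.mp hq
  obtain ⟨a, b, ha, hb⟩ := gDvd_one_add_I_iff.mp hc
  have hre := congrArg Complex.re h
  have him := congrArg Complex.im h
  rcases I_zpow_cases k with hk | hk | hk | hk <;> rw [hk] at hre him ⊢ <;>
    simp [ha, hb] at hre him
  · have h1 : a = 0 := int_eq_of_abs_sub_lt (by push_cast; linarith) (by push_cast; linarith)
    have h2 : b = 0 := int_eq_of_abs_sub_lt (by push_cast; linarith) (by push_cast; linarith)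
    subst h1 h2
    exact ⟨rfl, Complex.ext (by simp [ha]) (by simp [hb])⟩
  · exfalso
    have h1 : a = 0 := int_eq_of_abs_sub_lt (by push_cast; linarith) (by push_cast; linarith)
    have h2 : b = -1 := int_eq_of_abs_sub_lt (by push_cast; linarith) (by push_cast; linarith)
    subst h1 h2
    push_cast at hre him
    linarith
  · exfalso
    have h1 : a = 1 := int_eq_of_abs_sub_lt (by push_cast; linarith) (by push_cast; linarith)
    have h2 : b = -1 := int_eq_of_abs_sub_lt (by push_cast; linarith) (by push_cast; linarith)
    subst h1 h2
    push_cast at hre him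
    linarith
  · exfalso
    have h1 : a = 1 := int_eq_of_abs_sub_lt (by push_cast; linarith) (by push_cast; linarith)
    have h2 : b = 0 := int_eq_of_abs_sub_lt (by push_cast; linarith) (by push_cast; linarith)
    subst h1 h2
    push_cast at hre him
    linarith

theorem mem_frontier_Tri_of_translates_meet {k l : ℤ} {c d p q : ℂ}
    (hc : GDvd (1 + Complex.I) c) (hd : GDvd (1 + Complex.I) d)
    (hne : (Complex.I ^ k, c) ≠ (Complex.I ^ l, d)) (hp : p ∈ Tri) (hq : q ∈ Tri)
    (h : Complex.I ^ k * p + c = Complex.I ^ l * q + d) : p ∈ frontier Tri := by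
  rw [isClosed_Tri.frontier_eq]
  refine ⟨hp, fun hint => hne ?_⟩
  have hk : Complex.I ^ (-k) * Complex.I ^ k = 1 := by
    rw [← zpow_add₀ Complex.I_ne_zero]; simp
  have hlk : Complex.I ^ (l - k) = Complex.I ^ (-k) * Complex.I ^ l := by
    rw [← zpow_add₀ Complex.I_ne_zero]; congr 1; ring
  obtain ⟨h1, h2⟩ := eq_one_and_eq_zero_of_mem_interior_Tri (k := l - k)
    hint hq ((hd.sub hc).I_zpow_mul (-k))
    (by rw [hlk]; linear_combination Complex.I ^ (-k) * h - p * hk)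
  have h0 : Complex.I ^ (-k) ≠ 0 := zpow_ne_zero _ Complex.I_ne_zero
  rw [hlk, ← hk] at h1
  exact Prod.ext (mul_left_cancel₀ h0 h1).symm
    (sub_eq_zero.mp ((mul_eq_zero.mp h2).resolve_left h0)).symm

theorem exists_translate_Tri (z : ℂ) : ∃ (k : ℤ) (c w : ℂ), GDvd (1 + Complex.I) c ∧
    w ∈ Tri ∧ z = Complex.I ^ k * w + c := by
  obtain ⟨m, hm⟩ : ∃ m : ℤ, |(z.re - 1 + z.im) / 2 - m| ≤ 1 / 2 := ⟨_, abs_sub_round _⟩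
  obtain ⟨n, hn⟩ : ∃ n : ℤ, |(z.re - 1 - z.im) / 2 - n| ≤ 1 / 2 := ⟨_, abs_sub_round _⟩
  rw [abs_le] at hm hn
  obtain ⟨hm1, hm2⟩ := hm
  obtain ⟨hn1, hn2⟩ := hn
  have I3 : Complex.I ^ (3 : ℤ) = -Complex.I := by exact_mod_cast Complex.I_pow_three
  have I2 : Complex.I ^ (2 : ℤ) = -1 := by exact_mod_cast Complex.I_sq
  rcases le_total 0 (z.re - 1 - m - n) with hx | hx <;>
    rcases le_total 0 (z.im - m + n) with hy | hy
  · refine ⟨0, ⟨m + n, m - n⟩, ⟨z.re - m - n, z.im - m + n⟩,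
      gDvd_one_add_I_iff.mpr ⟨m, -n, by simp, by simp; ring⟩,
      mem_Tri_iff.mpr ⟨?_, ?_, ?_⟩, Complex.ext ?_ ?_⟩ <;> simp <;> linarith
  · refine ⟨3, ⟨m + n + 1, m - n + 1⟩, ⟨1 - (z.im - m + n), z.re - 1 - m - n⟩,
      gDvd_one_add_I_iff.mpr ⟨m + 1, -n, by simp; ring, by simp; ring⟩,
      mem_Tri_iff.mpr ⟨?_, ?_, ?_⟩, Complex.ext ?_ ?_⟩ <;> simp [I3] <;> linarith
  · refine ⟨1, ⟨m + n + 1, m - n - 1⟩, ⟨1 + (z.im - m + n), -(z.re - 1 - m - n)⟩,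
      gDvd_one_add_I_iff.mpr ⟨m, -n - 1, by simp; ring, by simp; ring⟩,
      mem_Tri_iff.mpr ⟨?_, ?_, ?_⟩, Complex.ext ?_ ?_⟩ <;> simp <;> linarith
  · refine ⟨2, ⟨m + n + 2, m - n⟩, ⟨1 - (z.re - 1 - m - n), -(z.im - m + n)⟩,
      gDvd_one_add_I_iff.mpr ⟨m + 1, -n - 1, by simp; ring, by simp; ring⟩,
      mem_Tri_iff.mpr ⟨?_, ?_, ?_⟩, Complex.ext ?_ ?_⟩ <;> simp [I2] <;> linarith

/-- The closed triangle `T = convexHull{1, 2, 1+i}` is an exact fundamental domain for the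
group of affine maps `w ↦ i^k·w + c`, `k ∈ ℤ`, `c ∈ (1+i)·ℤ[i]`, acting on `ℂ`: the
translates of `T` cover `ℂ`, and distinct group elements carry `T` to sets meeting only
along images of the frontier `∂T`. -/
theorem stmt14 :
    (∀ z : ℂ, ∃ (k : ℤ) (c w : ℂ), GDvd (1 + Complex.I) c ∧ w ∈ Tri ∧
      z = Complex.I ^ k * w + c) ∧
    (∀ u₁ c₁ u₂ c₂ : ℂ, (∃ k : ℤ, u₁ = Complex.I ^ k) → (∃ k : ℤ, u₂ = Complex.I ^ k) →
      GDvd (1 + Complex.I) c₁ → GDvd (1 + Complex.I) c₂ →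
      (u₁, c₁) ≠ (u₂, c₂) →
      ((fun w => u₁ * w + c₁) '' Tri) ∩ ((fun w => u₂ * w + c₂) '' Tri) ⊆
        ((fun w => u₁ * w + c₁) '' frontier Tri) ∩
          ((fun w => u₂ * w + c₂) '' frontier Tri)) := by
  refine ⟨exists_translate_Tri, ?_⟩
  rintro _ c₁ _ c₂ ⟨k, rfl⟩ ⟨l, rfl⟩ hc₁ hc₂ hne x ⟨⟨p, hp, hpx⟩, ⟨q, hq, hqx⟩⟩
  exact ⟨⟨p, mem_frontier_Tri_of_translates_meet hc₁ hc₂ hne hp hq (hpx.trans hqx.symm), hpx⟩,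
    ⟨q, mem_frontier_Tri_of_translates_meet hc₂ hc₁ hne.symm hq hp (hqx.trans hpx.symm), hqx⟩⟩
end
end

section
/- Let Γ'_ℝ = Γ' ∩ SL(2,ℝ). Then a matrix g ∈ SL(2,ℝ) belongs to Γ'_ℝ if and only if either (i) g has integer entries and the entries of g reduce modulo 2 to !![1,0;0,1] or !![0,1;1,0], or (ii) g = (1/√2) · h · !![1,−1;0,2] for some h ∈ SL(2,ℤ) whose entries reduce modulo 2 to !![1,1;1,0] or !![1,0;1,1]. -/
open Complex Matrix

noncomputable section

theorem isGauss_ofReal_iff (x : ℝ) : IsGauss (x : ℂ) ↔ ∃ n : ℤ, x = n := by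
  constructor
  · rintro ⟨a, b, h⟩
    exact ⟨a, by simpa using congrArg Complex.re h⟩
  · rintro ⟨n, rfl⟩
    exact ⟨n, 0, by simp⟩

theorem isGauss_I_mul_ofReal_iff (x : ℝ) :
    IsGauss (Complex.I * (x : ℂ)) ↔ ∃ n : ℤ, x = n := by
  constructor
  · rintro ⟨a, b, h⟩
    exact ⟨b, by simpa using congrArg Complex.im h⟩
  · rintro ⟨n, rfl⟩
    exact ⟨0, n, by simp [mul_comm]⟩

theorem gCong_two_intCast_iff (n m : ℤ) : GCong 2 (n : ℂ) (m : ℂ) ↔ (2 : ℤ) ∣ n - m := by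
  constructor
  · rintro ⟨k, ⟨a, b, rfl⟩, h⟩
    refine ⟨a, ?_⟩
    have : (n - m : ℝ) = 2 * a := by simpa using congrArg Complex.re h
    exact_mod_cast this
  · rintro ⟨k, h⟩
    exact ⟨k, ⟨k, 0, by simp⟩, by exact_mod_cast h⟩

theorem gCong_two_intCast_zero_iff (n : ℤ) : GCong 2 (n : ℂ) 0 ↔ n % 2 = 0 := by
  have := gCong_two_intCast_iff n 0
  rw [Int.cast_zero] at this
  rw [this]
  omega

theorem gCong_two_intCast_one_iff (n : ℤ) : GCong 2 (n : ℂ) 1 ↔ n % 2 = 1 := by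
  have := gCong_two_intCast_iff n 1
  rw [Int.cast_one] at this
  rw [this]
  omega

/-- Integrality of the entries of `CMat` for a real matrix `!![a, b; c, d]`. -/
theorem isGauss_CMat_ofReal_iff (g : Matrix (Fin 2) (Fin 2) ℂ) (a b c d : ℝ)
    (ha : g 0 0 = a) (hb : g 0 1 = b) (hc : g 1 0 = c) (hd : g 1 1 = d) :
    (∀ i j, IsGauss (CMat g i j)) ↔
      (∃ n : ℤ, (a ^ 2 - c ^ 2 + d ^ 2 - b ^ 2) / 2 = n) ∧
      (∃ n : ℤ, (a ^ 2 - c ^ 2 + b ^ 2 - d ^ 2) / 2 = n) ∧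
      (∃ n : ℤ, c * d - a * b = n) ∧
      (∃ n : ℤ, (b ^ 2 + d ^ 2 - a ^ 2 - c ^ 2) / 2 = n) ∧
      (∃ n : ℤ, (a ^ 2 + c ^ 2 + b ^ 2 + d ^ 2) / 2 = n) ∧
      (∃ n : ℤ, a * b + c * d = n) ∧
      (∃ n : ℤ, -(a * c) + b * d = n) ∧
      (∃ n : ℤ, a * c + b * d = n) ∧
      (∃ n : ℤ, a * d + b * c = n) := by
  simp only [← isGauss_ofReal_iff ((a ^ 2 - c ^ 2 + d ^ 2 - b ^ 2) / 2),
    ← isGauss_I_mul_ofReal_iff ((a ^ 2 - c ^ 2 + b ^ 2 - d ^ 2) / 2),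
    ← isGauss_ofReal_iff (c * d - a * b),
    ← isGauss_I_mul_ofReal_iff ((b ^ 2 + d ^ 2 - a ^ 2 - c ^ 2) / 2),
    ← isGauss_ofReal_iff ((a ^ 2 + c ^ 2 + b ^ 2 + d ^ 2) / 2),
    ← isGauss_I_mul_ofReal_iff (a * b + c * d),
    ← isGauss_ofReal_iff (-(a * c) + b * d),
    ← isGauss_I_mul_ofReal_iff (a * c + b * d),
    ← isGauss_ofReal_iff (a * d + b * c)]
  simp [Fin.forall_fin_succ, CMat, ha, hb, hc, hd, mul_div_assoc, and_assoc]

/-- If `a²`, `ab`, `b²` are integers with `a²` prime to the integral determinant, then `a` and `b`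
are integers. -/
theorem exists_int_eq_of_sq_eq {a b c d : ℝ} {A B C D E F δ : ℤ} (hA : a ^ 2 = A)
    (hB : b ^ 2 = B) (hC : c ^ 2 = C) (hD : d ^ 2 = D) (hE : a * b = E) (hF : c * d = F)
    (hδ : a * d - b * c = δ) (hcop : IsCoprime A δ) :
    ∃ k l : ℤ, a = k ∧ b = l := by
  have hEq : A * B = E ^ 2 := by
    have : (A * B : ℝ) = E ^ 2 := by rw [← hA, ← hB, ← hE]; ring
    exact_mod_cast this
  have hdet : A * D - 2 * E * F + B * C = δ ^ 2 := by
    have : (A * D - 2 * E * F + B * C : ℝ) = δ ^ 2 := by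
      rw [← hA, ← hB, ← hC, ← hD, ← hE, ← hF, ← hδ]; ring
    exact_mod_cast this
  have hδ0 : ¬ (A = 0 ∧ B = 0) := by
    rintro ⟨rfl, rfl⟩
    have hE0 : E = 0 := by simpa using hEq.symm
    have : δ = 0 := by simpa [hE0] using hdet.symm
    rw [this] at hcop
    exact not_isCoprime_zero_zero hcop
  have hAB : IsCoprime A B := by
    refine isCoprime_of_prime_dvd hδ0 ?_
    intro p hp hpA hpB
    have hpE : p ∣ E := hp.dvd_of_dvd_pow (hEq ▸ hpA.mul_right B)
    have hpδ : p ∣ δ := by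
      refine hp.dvd_of_dvd_pow (n := 2) ?_
      rw [← hdet]
      exact ((hpA.mul_right D).sub ((hpE.mul_left 2).mul_right F)).add (hpB.mul_right C)
    exact hp.not_isUnit (hcop.isUnit_of_dvd' hpA hpδ)
  have key : ∀ {x : ℝ} {X Y : ℤ}, x ^ 2 = X → IsCoprime X Y → X * Y = E ^ 2 →
      ∃ k : ℤ, x = k := by
    intro x X Y hx hXY hXE
    obtain ⟨k, hk | hk⟩ := Int.sq_of_isCoprime hXY hXE
    · have h2 : x ^ 2 = (k : ℝ) ^ 2 := by rw [hx, hk]; push_cast; ring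
      rcases sq_eq_sq_iff_eq_or_eq_neg.mp h2 with h | h
      · exact ⟨k, h⟩
      · exact ⟨-k, by rw [h]; push_cast; ring⟩
    · refine ⟨0, ?_⟩
      have : x ^ 2 = -(k : ℝ) ^ 2 := by rw [hx, hk]; push_cast; ring
      have : x ^ 2 = 0 := le_antisymm (by nlinarith [sq_nonneg (k : ℝ)]) (sq_nonneg x)
      simpa using this
  obtain ⟨k, hk⟩ := key hA hAB hEq
  obtain ⟨l, hl⟩ := key hB hAB.symm (by rw [mul_comm]; exact hEq)
  exact ⟨k, l, hk, hl⟩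

/-- A real matrix of determinant `1` satisfying the integrality conditions is either integral or
`1 / √2` times a matrix with odd integral entries. -/
theorem exists_int_of_integrality {a b c d : ℝ} (hdet : a * d - b * c = 1)
    (h₁ : ∃ n : ℤ, (a ^ 2 - c ^ 2 + d ^ 2 - b ^ 2) / 2 = n)
    (h₂ : ∃ n : ℤ, (a ^ 2 - c ^ 2 + b ^ 2 - d ^ 2) / 2 = n)
    (h₃ : ∃ n : ℤ, c * d - a * b = n)
    (h₄ : ∃ n : ℤ, (b ^ 2 + d ^ 2 - a ^ 2 - c ^ 2) / 2 = n)
    (h₅ : ∃ n : ℤ, (a ^ 2 + c ^ 2 + b ^ 2 + d ^ 2) / 2 = n)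
    (h₆ : ∃ n : ℤ, a * b + c * d = n) :
    ∃ k l m n : ℤ,
      (a = k ∧ b = l ∧ c = m ∧ d = n ∧ (k + l + m + n) % 2 = 0) ∨
      (√2 * a = k ∧ √2 * b = l ∧ √2 * c = m ∧ √2 * d = n ∧
        k % 2 = 1 ∧ l % 2 = 1 ∧ m % 2 = 1 ∧ n % 2 = 1) := by
  obtain ⟨Q, hQ⟩ := h₁
  obtain ⟨R, hR⟩ := h₂
  obtain ⟨T, hT⟩ := h₃
  obtain ⟨S, hS⟩ := h₄
  obtain ⟨P, hP⟩ := h₅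
  obtain ⟨U, hU⟩ := h₆
  have hA : 2 * a ^ 2 = ((P + Q + R - S : ℤ) : ℝ) := by push_cast; linarith
  have hB : 2 * b ^ 2 = ((P - Q + R + S : ℤ) : ℝ) := by push_cast; linarith
  have hC : 2 * c ^ 2 = ((P - Q - R - S : ℤ) : ℝ) := by push_cast; linarith
  have hD : 2 * d ^ 2 = ((P + Q - R + S : ℤ) : ℝ) := by push_cast; linarith
  have hE : 2 * (a * b) = ((U - T : ℤ) : ℝ) := by push_cast; linarith
  have hF : 2 * (c * d) = ((U + T : ℤ) : ℝ) := by push_cast; linarith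
  rcases Int.even_or_odd' (P + Q + R - S) with ⟨A, hA' | hA'⟩
  · have hAr : a ^ 2 = A := by rw [hA'] at hA; push_cast at hA; linarith
    obtain ⟨B, hB'⟩ : ∃ B, P - Q + R + S = 2 * B := ⟨A - Q + S, by omega⟩
    obtain ⟨C, hC'⟩ : ∃ C, P - Q - R - S = 2 * C := ⟨A - Q - R, by omega⟩
    obtain ⟨D, hD'⟩ : ∃ D, P + Q - R + S = 2 * D := ⟨A - R + S, by omega⟩
    have hBr : b ^ 2 = B := by rw [hB'] at hB; push_cast at hB; linarith
    have hCr : c ^ 2 = C := by rw [hC'] at hC; push_cast at hC; linarith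
    have hDr : d ^ 2 = D := by rw [hD'] at hD; push_cast at hD; linarith
    have even_of {x y : ℝ} {X Y Z : ℤ} (hx : x ^ 2 = X) (hy : y ^ 2 = Y)
        (hxy : 2 * (x * y) = Z) : ∃ W : ℤ, x * y = W := by
      have h : Z ^ 2 = 2 * (2 * (X * Y)) := by
        have : (Z : ℝ) ^ 2 = 2 * (2 * (X * Y)) := by rw [← hx, ← hy, ← hxy]; ring
        exact_mod_cast this
      obtain ⟨W, rfl⟩ : (2 : ℤ) ∣ Z := Int.prime_two.dvd_of_dvd_pow ⟨_, h⟩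
      exact ⟨W, by push_cast at hxy; linarith⟩
    obtain ⟨E, hEr⟩ := even_of hAr hBr hE
    obtain ⟨F, hFr⟩ := even_of hCr hDr hF
    obtain ⟨k, l, hk, hl⟩ := exists_int_eq_of_sq_eq (δ := 1) hAr hBr hCr hDr hEr hFr
      (by simpa using hdet) isCoprime_one_right
    obtain ⟨m, n, hm, hn⟩ := exists_int_eq_of_sq_eq (δ := -1) hCr hDr hAr hBr hFr hEr
      (by push_cast; linarith) isCoprime_one_right.neg_right
    refine ⟨k, l, m, n, Or.inl ⟨hk, hl, hm, hn, ?_⟩⟩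
    have hsum : k ^ 2 + m ^ 2 + l ^ 2 + n ^ 2 = 2 * P := by
      have : (k ^ 2 + m ^ 2 + l ^ 2 + n ^ 2 : ℝ) = 2 * P := by
        rw [← hk, ← hl, ← hm, ← hn]; linarith
      exact_mod_cast this
    have : Even (k ^ 2 + m ^ 2 + l ^ 2 + n ^ 2) := ⟨P, by omega⟩
    have : Even (k + l + m + n) := by
      simp only [Int.even_add, Int.even_pow' two_ne_zero] at this ⊢
      tauto
    exact Int.even_iff.mp this
  · have h2 : √2 ^ 2 = (2 : ℝ) := Real.sq_sqrt zero_le_two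
    have hs (x y : ℝ) : (√2 * x) * (√2 * y) = 2 * (x * y) := by
      linear_combination (x * y) * h2
    have hsq (x : ℝ) : (√2 * x) ^ 2 = 2 * x ^ 2 := by rw [mul_pow, h2]
    have hodd {X : ℤ} (hX : X % 2 = 1) : IsCoprime X 2 := by
      refine ⟨1, -(X / 2), by omega⟩
    obtain ⟨k, l, hk, hl⟩ := exists_int_eq_of_sq_eq (δ := 2) ((hsq a).trans hA)
      ((hsq b).trans hB) ((hsq c).trans hC) ((hsq d).trans hD) ((hs a b).trans hE)
      ((hs c d).trans hF) (by rw [hs, hs]; push_cast; linarith) (hodd (by omega))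
    obtain ⟨m, n, hm, hn⟩ := exists_int_eq_of_sq_eq (δ := -2) ((hsq c).trans hC)
      ((hsq d).trans hD) ((hsq a).trans hA) ((hsq b).trans hB) ((hs c d).trans hF)
      ((hs a b).trans hE) (by rw [hs, hs]; push_cast; linarith) (hodd (by omega)).neg_right
    have parity {x : ℝ} {j X : ℤ} (hj : √2 * x = j) (hX : 2 * x ^ 2 = X) (hX' : X % 2 = 1) :
        j % 2 = 1 := by
      have h : j ^ 2 = X := by
        have : (j : ℝ) ^ 2 = X := by rw [← hj, hsq, hX]
        exact_mod_cast this
      rw [← Int.odd_iff] at hX' ⊢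
      rw [← h] at hX'
      exact (Int.odd_pow' two_ne_zero).mp hX'
    exact ⟨k, l, m, n, Or.inr ⟨hk, hl, hm, hn, parity hk hA (by omega), parity hl hB (by omega),
      parity hm hC (by omega), parity hn hD (by omega)⟩⟩

theorem emod_two_of_det_eq_one {k l m n : ℤ} (hdet : k * n - l * m = 1)
    (hsum : (k + l + m + n) % 2 = 0) :
    (k % 2 = 1 ∧ l % 2 = 0 ∧ m % 2 = 0 ∧ n % 2 = 1) ∨
      (k % 2 = 0 ∧ l % 2 = 1 ∧ m % 2 = 1 ∧ n % 2 = 0) := by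
  have h : (k * n - l * m) % 2 = 1 := by rw [hdet]; rfl
  rw [Int.sub_emod, Int.mul_emod k, Int.mul_emod l] at h
  rcases Int.emod_two_eq_zero_or_one k with hk | hk <;>
  rcases Int.emod_two_eq_zero_or_one l with hl | hl <;>
  rcases Int.emod_two_eq_zero_or_one m with hm | hm <;>
  rcases Int.emod_two_eq_zero_or_one n with hn | hn <;>
  rw [hk, hl, hm, hn] at h <;> omega

theorem emod_two_add_of_det_eq_one {k p m q : ℤ} (hdet : k * q - p * m = 1) (hk : k % 2 = 1)
    (hm : m % 2 = 1) : (p + q) % 2 = 1 := by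
  have h : (k * q - p * m) % 2 = 1 := by rw [hdet]; rfl
  rw [Int.sub_emod, Int.mul_emod k, Int.mul_emod p, hk, hm] at h
  omega

theorem integrality_of_int {k l m n : ℤ}
    (hsum : (k + l + m + n) % 2 = 0) {g : Matrix (Fin 2) (Fin 2) ℂ}
    (hk : g 0 0 = k) (hl : g 0 1 = l) (hm : g 1 0 = m) (hn : g 1 1 = n) :
    ∀ i j, IsGauss (CMat g i j) := by
  rw [isGauss_CMat_ofReal_iff g k l m n (by simpa using hk) (by simpa using hl)
    (by simpa using hm) (by simpa using hn)]
  have hP : Even (k ^ 2 + m ^ 2 + l ^ 2 + n ^ 2) := by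
    have := Int.even_iff.mpr hsum
    simp only [Int.even_add, Int.even_pow' two_ne_zero] at this ⊢
    tauto
  obtain ⟨P, hP⟩ := hP
  have hPr : (k ^ 2 + m ^ 2 + l ^ 2 + n ^ 2 : ℝ) = P + P := by exact_mod_cast hP
  refine ⟨⟨P - m ^ 2 - l ^ 2, ?_⟩, ⟨P - m ^ 2 - n ^ 2, ?_⟩, ⟨m * n - k * l, ?_⟩,
    ⟨P - k ^ 2 - m ^ 2, ?_⟩, ⟨P, ?_⟩, ⟨k * l + m * n, ?_⟩, ⟨-(k * m) + l * n, ?_⟩,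
    ⟨k * m + l * n, ?_⟩, ⟨k * n + l * m, ?_⟩⟩ <;> push_cast <;> linarith

theorem integrality_of_odd {k l m n : ℤ} (hk : k % 2 = 1) (hl : l % 2 = 1) (hm : m % 2 = 1)
    (hn : n % 2 = 1) {g : Matrix (Fin 2) (Fin 2) ℂ}
    (ha : g 0 0 = ((√2)⁻¹ * k : ℝ)) (hb : g 0 1 = ((√2)⁻¹ * l : ℝ))
    (hc : g 1 0 = ((√2)⁻¹ * m : ℝ)) (hd : g 1 1 = ((√2)⁻¹ * n : ℝ)) :
    ∀ i j, IsGauss (CMat g i j) := by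
  rw [isGauss_CMat_ofReal_iff g _ _ _ _ ha hb hc hd]
  have h2 : ((√2)⁻¹ : ℝ) ^ 2 = 1 / 2 := by rw [inv_pow, Real.sq_sqrt zero_le_two]; norm_num
  have hs (x y : ℝ) : ((√2)⁻¹ * x) * ((√2)⁻¹ * y) = x * y / 2 := by
    linear_combination (x * y) * h2
  obtain ⟨K, rfl⟩ : ∃ K, k = 2 * K + 1 := ⟨k / 2, by omega⟩
  obtain ⟨L, rfl⟩ : ∃ L, l = 2 * L + 1 := ⟨l / 2, by omega⟩
  obtain ⟨M, rfl⟩ : ∃ M, m = 2 * M + 1 := ⟨m / 2, by omega⟩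
  obtain ⟨N, rfl⟩ : ∃ N, n = 2 * N + 1 := ⟨n / 2, by omega⟩
  simp only [hs, mul_pow, h2]
  refine ⟨⟨K ^ 2 + K - M ^ 2 - M + N ^ 2 + N - L ^ 2 - L, ?_⟩,
    ⟨K ^ 2 + K - M ^ 2 - M + L ^ 2 + L - N ^ 2 - N, ?_⟩,
    ⟨2 * M * N + M + N - 2 * K * L - K - L, ?_⟩,
    ⟨L ^ 2 + L + N ^ 2 + N - K ^ 2 - K - M ^ 2 - M, ?_⟩,
    ⟨K ^ 2 + K + M ^ 2 + M + L ^ 2 + L + N ^ 2 + N + 1, ?_⟩,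
    ⟨2 * M * N + M + N + 2 * K * L + K + L + 1, ?_⟩,
    ⟨2 * L * N + L + N - 2 * K * M - K - M, ?_⟩,
    ⟨2 * L * N + L + N + 2 * K * M + K + M + 1, ?_⟩,
    ⟨2 * K * N + K + N + 2 * L * M + L + M + 1, ?_⟩⟩ <;> push_cast <;> ring

/-- Characterization of `Γ'_ℝ = Γ' ∩ SL(2,ℝ)`: a real matrix `g` of determinant `1` has
all entries of `C(g)` in `ℤ[i]` iff either (i) `g` has integer entries reducing mod `2` to
`!![1,0;0,1]` or `!![0,1;1,0]`, or (ii) `g = (1/√2)·h·!![1,−1;0,2]` for some `h ∈ SL(2,ℤ)`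
reducing mod `2` to `!![1,1;1,0]` or `!![1,0;1,1]`. -/
theorem stmt16 (g : Matrix (Fin 2) (Fin 2) ℂ) (hdet : g.det = 1)
    (hreal : ∀ i j, (g i j).im = 0) :
    (∀ i j, IsGauss (CMat g i j)) ↔
      (((∀ i j, ∃ n : ℤ, g i j = (n : ℂ)) ∧
        ((GCong 2 (g 0 0) 1 ∧ GCong 2 (g 0 1) 0 ∧ GCong 2 (g 1 0) 0 ∧ GCong 2 (g 1 1) 1) ∨
         (GCong 2 (g 0 0) 0 ∧ GCong 2 (g 0 1) 1 ∧ GCong 2 (g 1 0) 1 ∧ GCong 2 (g 1 1) 0))) ∨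
       (∃ h : Matrix (Fin 2) (Fin 2) ℂ, (∀ i j, ∃ n : ℤ, h i j = (n : ℂ)) ∧ h.det = 1 ∧
        ((GCong 2 (h 0 0) 1 ∧ GCong 2 (h 0 1) 1 ∧ GCong 2 (h 1 0) 1 ∧ GCong 2 (h 1 1) 0) ∨
         (GCong 2 (h 0 0) 1 ∧ GCong 2 (h 0 1) 0 ∧ GCong 2 (h 1 0) 1 ∧ GCong 2 (h 1 1) 1)) ∧
        g = ((Real.sqrt 2 : ℂ))⁻¹ • (h * !![1, -1; 0, 2]))) := by
  have hre (i j) : g i j = ((g i j).re : ℂ) :=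
    Complex.ext (by simp) (by simpa using hreal i j)
  rw [det_fin_two] at hdet
  constructor
  · intro h
    rw [isGauss_CMat_ofReal_iff g _ _ _ _ (hre 0 0) (hre 0 1) (hre 1 0) (hre 1 1)] at h
    obtain ⟨h₁, h₂, h₃, h₄, h₅, h₆, -⟩ := h
    have hdet' : (g 0 0).re * (g 1 1).re - (g 0 1).re * (g 1 0).re = 1 := by
      rw [hre 0 0, hre 0 1, hre 1 0, hre 1 1] at hdet
      exact_mod_cast hdet
    obtain ⟨k, l, m, n, ⟨hk, hl, hm, hn, hsum⟩ | ⟨hk, hl, hm, hn, hk2, hl2, hm2, hn2⟩⟩ :=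
      exists_int_of_integrality hdet' h₁ h₂ h₃ h₄ h₅ h₆
    · left
      have hk' : g 0 0 = k := by rw [hre 0 0, hk]; simp
      have hl' : g 0 1 = l := by rw [hre 0 1, hl]; simp
      have hm' : g 1 0 = m := by rw [hre 1 0, hm]; simp
      have hn' : g 1 1 = n := by rw [hre 1 1, hn]; simp
      rw [hk, hl, hm, hn] at hdet'
      have hd : k * n - l * m = 1 := by exact_mod_cast hdet'
      refine ⟨?_, ?_⟩
      · simp only [Fin.forall_fin_two]
        exact ⟨⟨⟨k, hk'⟩, ⟨l, hl'⟩⟩, ⟨⟨m, hm'⟩, ⟨n, hn'⟩⟩⟩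
      · rw [hk', hl', hm', hn']
        simp only [gCong_two_intCast_zero_iff, gCong_two_intCast_one_iff]
        exact emod_two_of_det_eq_one hd hsum
    · right
      have hd : k * n - l * m = 2 := by
        have h2 : √2 ^ 2 = (2 : ℝ) := Real.sq_sqrt zero_le_two
        have : (k * n - l * m : ℝ) = 2 := by
          rw [← hk, ← hl, ← hm, ← hn]
          linear_combination √2 ^ 2 * hdet' + h2
        exact_mod_cast this
      obtain ⟨p, hp⟩ : ∃ p, l = 2 * p - k := ⟨(k + l) / 2, by omega⟩
      obtain ⟨q, hq⟩ : ∃ q, n = 2 * q - m := ⟨(m + n) / 2, by omega⟩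
      subst hp hq
      have hpq : k * q - p * m = 1 := by linarith
      have hent {i j} {z : ℤ} (hz : √2 * (g i j).re = z) : g i j = ((√2 : ℝ) : ℂ)⁻¹ * z := by
        have h0 : √2 ≠ 0 := by positivity
        have : (g i j).re = (√2)⁻¹ * z := by rw [← hz]; field_simp
        rw [hre i j, this]
        push_cast
        rfl
      refine ⟨!![(k : ℂ), p; m, q], ?_, ?_, ?_, ?_⟩
      · simp only [Fin.forall_fin_two]
        exact ⟨⟨⟨k, rfl⟩, ⟨p, rfl⟩⟩, ⟨⟨m, rfl⟩, ⟨q, rfl⟩⟩⟩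
      · rw [det_fin_two_of]
        exact_mod_cast hpq
      · simp only [of_apply, cons_val', cons_val_zero, cons_val_one, cons_val_fin_one,
          gCong_two_intCast_zero_iff, gCong_two_intCast_one_iff]
        have hodd := emod_two_add_of_det_eq_one hpq hk2 hm2
        omega
      · ext i j
        fin_cases i <;> fin_cases j
        · simpa using hent hk
        · simpa [Matrix.mul_apply, Fin.sum_univ_two, mul_comm, add_comm, sub_eq_add_neg]
            using hent hl
        · simpa using hent hm
        · simpa [Matrix.mul_apply, Fin.sum_univ_two, mul_comm, add_comm, sub_eq_add_neg]
            using hent hn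
  · rintro (⟨hz, hpar⟩ | ⟨h, hz, -, hpar, hg⟩)
    · obtain ⟨k, hk⟩ := hz 0 0
      obtain ⟨l, hl⟩ := hz 0 1
      obtain ⟨m, hm⟩ := hz 1 0
      obtain ⟨n, hn⟩ := hz 1 1
      rw [hk, hl, hm, hn] at hpar
      simp only [gCong_two_intCast_zero_iff, gCong_two_intCast_one_iff] at hpar
      exact integrality_of_int (by omega) hk hl hm hn
    · obtain ⟨k, hk⟩ := hz 0 0
      obtain ⟨p, hp⟩ := hz 0 1
      obtain ⟨m, hm⟩ := hz 1 0
      obtain ⟨q, hq⟩ := hz 1 1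
      rw [hk, hp, hm, hq] at hpar
      simp only [gCong_two_intCast_zero_iff, gCong_two_intCast_one_iff] at hpar
      refine integrality_of_odd (k := k) (l := 2 * p - k) (m := m) (n := 2 * q - m)
        (by omega) (by omega) (by omega) (by omega) ?_ ?_ ?_ ?_ <;>
      · rw [hg]
        simp [Matrix.mul_apply, Fin.sum_univ_two, hk, hp, hm, hq]
        try ring
end
end
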